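/- Let 0 < ε < 10⁻³, let k = 2^{20/ε}, and let n > k² be an integer. Suppose G is a multigraph in which any two vertices are joined by at most n/k parallel edges, and G is properly edge-coloured with n colours so that every colour appears on at least (1+ε)n edges. Then G has a rainbow matching of size n − k. -/

import Mathlib

/-
A multigraph on vertex type `V` is given by an edge type `E` with two endpoint
maps `fst snd : E → V` (no loops: `fst e ≠ snd e`); parallel edges are allowed
since distinct elements of `E` may have the same endpoints.  A colouring
`col : E → C` by a set `C` of `n` colours is proper if any two distinct edges
sharing a vertex get distinct colours.
-/

attribute [local instance] Classical.propDecidable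

/-- The set of endpoints of an edge. -/
def endpts {V E : Type*} [DecidableEq V] (fst snd : E → V) (e : E) : Finset V :=
  {fst e, snd e}

/-- A set of edges is a rainbow matching: pairwise vertex-disjoint edges with
pairwise distinct colours. -/
def IsRainbowMatching {V E C : Type*} [DecidableEq V] (fst snd : E → V) (col : E → C)
    (S : Finset E) : Prop :=
  (∀ e ∈ S, ∀ f ∈ S, e ≠ f → endpts fst snd e ∩ endpts fst snd f = ∅) ∧
  (∀ e ∈ S, ∀ f ∈ S, col e = col f → e = f)

/-- `V(M)`: the set of vertices covered by a set of edges `M`. -/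
def mVerts {V E : Type*} [DecidableEq V] (fst snd : E → V) (M : Finset E) : Finset V :=
  M.biUnion (endpts fst snd)

/-- The set of colours used by a set of edges `M`. -/
def mCols {E C : Type*} [DecidableEq C] (col : E → C) (M : Finset E) : Finset C :=
  M.image col


set_option linter.unusedSectionVars false

section Freeing

variable {V E C : Type*} [Fintype V] [DecidableEq V] [DecidableEq E] [DecidableEq C]
  {fst snd : E → V} {col : E → C} {M : Finset E} {C₀ : Finset C} {P : ℕ}

lemma mem_mVerts {R : Finset E} {v : V} :
    v ∈ mVerts fst snd R ↔ ∃ e ∈ R, v ∈ endpts fst snd e := by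
  simp [mVerts]

lemma mem_mCols {R : Finset E} {c : C} : c ∈ mCols col R ↔ ∃ e ∈ R, col e = c := by
  simp [mCols]

lemma IsRainbowMatching.eq_of_mem (hM : IsRainbowMatching fst snd col M) {e f : E}
    (he : e ∈ M) (hf : f ∈ M) {v : V} (hve : v ∈ endpts fst snd e)
    (hvf : v ∈ endpts fst snd f) : e = f := by
  by_contra hne
  have := hM.1 e he f hf hne
  have hv : v ∈ endpts fst snd e ∩ endpts fst snd f := Finset.mem_inter.2 ⟨hve, hvf⟩
  rw [this] at hv
  simp at hv

/-- Relative to a rainbow matching `M` and a set `C₀` of colours unused by `M`, the vertices `X` and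
the colours `D` are freeable with support `S` at cost `s` if, whatever small sets of vertices
(disjoint from `S`) and of unused colours are forbidden, one can replace edges of `M` lying inside
`S` by equally many (at most `s`) edges so as to obtain a rainbow matching missing `X` and `D`. -/
def Freeable (fst snd : E → V) (col : E → C) (M : Finset E) (C₀ : Finset C) (P : ℕ)
    (S X : Finset V) (D : Finset C) (s : ℕ) : Prop :=
  X ⊆ S ∧ ∀ (F : Finset V) (Q : Finset C), Disjoint F S → Q ⊆ C₀ →
    F.card + S.card + 2 * s ≤ P → Q.card + s ≤ P →
    ∃ R N : Finset E, R ⊆ M ∧ N.card = R.card ∧ N.card ≤ s ∧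
      IsRainbowMatching fst snd col N ∧
      mVerts fst snd R ⊆ S ∧ X ⊆ mVerts fst snd R ∪ (mVerts fst snd M)ᶜ ∧
      mVerts fst snd N ⊆ mVerts fst snd R ∪ (mVerts fst snd M)ᶜ ∧
      Disjoint (mVerts fst snd N) X ∧ Disjoint (mVerts fst snd N) F ∧
      D ⊆ mCols col R ∧ mCols col N ⊆ mCols col R ∪ C₀ ∧
      Disjoint (mCols col N) D ∧ Disjoint (mCols col N) Q

lemma Freeable.mono {S X : Finset V} {D D' : Finset C} {s s' : ℕ}
    (h : Freeable fst snd col M C₀ P S X D s) (hD : D' ⊆ D) (hs : s ≤ s') :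
    Freeable fst snd col M C₀ P S X D' s' := by
  refine ⟨h.1, fun F Q hF hQ h1 h2 => ?_⟩
  obtain ⟨R, N, a1, a2, a3, a4, a5, a6, a7, a8, a9, a10, a11, a12, a13⟩ :=
    h.2 F Q hF hQ (by omega) (by omega)
  exact ⟨R, N, a1, a2, by omega, a4, a5, a6, a7, a8, a9, hD.trans a10, a11,
    a12.mono_right hD, a13⟩

lemma freeable_of_notMem {v : V} (hv : v ∉ mVerts fst snd M) :
    Freeable fst snd col M C₀ P {v} {v} ∅ 0 := by
  refine ⟨subset_rfl, fun F Q hF hQ h1 h2 => ⟨∅, ∅, ?_⟩⟩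
  simp [IsRainbowMatching, mVerts, mCols]
  simpa [mVerts] using hv

lemma IsRainbowMatching.union {N₁ N₂ : Finset E} (h₁ : IsRainbowMatching fst snd col N₁)
    (h₂ : IsRainbowMatching fst snd col N₂)
    (hV : Disjoint (mVerts fst snd N₁) (mVerts fst snd N₂))
    (hC : Disjoint (mCols col N₁) (mCols col N₂)) :
    IsRainbowMatching fst snd col (N₁ ∪ N₂) := by
  have hV' : ∀ e ∈ N₁, ∀ f ∈ N₂, endpts fst snd e ∩ endpts fst snd f = ∅ := by
    intro e he f hf
    rw [← Finset.disjoint_iff_inter_eq_empty]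
    exact hV.mono (fun v hv => mem_mVerts.2 ⟨e, he, hv⟩) (fun v hv => mem_mVerts.2 ⟨f, hf, hv⟩)
  have hC' : ∀ e ∈ N₁, ∀ f ∈ N₂, col e ≠ col f := by
    intro e he f hf
    exact Finset.disjoint_iff_ne.1 hC _ (mem_mCols.2 ⟨e, he, rfl⟩) _ (mem_mCols.2 ⟨f, hf, rfl⟩)
  refine ⟨fun e he f hf hne => ?_, fun e he f hf hef => ?_⟩
  · rcases Finset.mem_union.1 he with he | he <;> rcases Finset.mem_union.1 hf with hf | hf
    · exact h₁.1 e he f hf hne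
    · exact hV' e he f hf
    · rw [Finset.inter_comm]; exact hV' f hf e he
    · exact h₂.1 e he f hf hne
  · rcases Finset.mem_union.1 he with he | he <;> rcases Finset.mem_union.1 hf with hf | hf
    · exact h₁.2 e he f hf hef
    · exact absurd hef (hC' e he f hf)
    · exact absurd hef.symm (hC' f hf e he)
    · exact h₂.2 e he f hf hef

lemma isRainbowMatching_singleton (e : E) : IsRainbowMatching fst snd col {e} := by
  constructor <;> simp +contextual

lemma IsRainbowMatching.mono {N N' : Finset E} (h : IsRainbowMatching fst snd col N)
    (hN : N' ⊆ N) : IsRainbowMatching fst snd col N' :=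
  ⟨fun e he f hf => h.1 e (hN he) f (hN hf), fun e he f hf => h.2 e (hN he) f (hN hf)⟩

lemma mVerts_union (N₁ N₂ : Finset E) :
    mVerts fst snd (N₁ ∪ N₂) = mVerts fst snd N₁ ∪ mVerts fst snd N₂ := by
  ext v; simp only [mem_mVerts, Finset.mem_union]; grind

lemma mCols_union (N₁ N₂ : Finset E) : mCols col (N₁ ∪ N₂) = mCols col N₁ ∪ mCols col N₂ :=
  Finset.image_union _ _

lemma mVerts_singleton (e : E) : mVerts fst snd {e} = endpts fst snd e := by
  simp [mVerts]

lemma mCols_singleton (e : E) : mCols col {e} = {col e} := by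
  simp [mCols]

lemma mVerts_mono {R R' : Finset E} (h : R ⊆ R') : mVerts fst snd R ⊆ mVerts fst snd R' :=
  Finset.biUnion_subset_biUnion_of_subset_left _ h

lemma mCols_mono {R R' : Finset E} (h : R ⊆ R') : mCols col R ⊆ mCols col R' :=
  Finset.image_subset_image h

lemma card_endpts_le (e : E) : (endpts fst snd e).card ≤ 2 := Finset.card_le_two

lemma card_mVerts_le (R : Finset E) : (mVerts fst snd R).card ≤ 2 * R.card := by
  rw [mul_comm]
  exact Finset.card_biUnion_le_card_mul _ _ _ fun e _ => card_endpts_le e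

lemma endpts_nonempty (e : E) : (endpts fst snd e).Nonempty := ⟨fst e, by simp [endpts]⟩

lemma disjoint_of_mVerts {R₁ R₂ : Finset E}
    (h : Disjoint (mVerts fst snd R₁) (mVerts fst snd R₂)) : Disjoint R₁ R₂ := by
  rw [Finset.disjoint_left]
  intro e h1 h2
  obtain ⟨v, hv⟩ := endpts_nonempty (fst := fst) (snd := snd) e
  exact Finset.disjoint_left.1 h (mem_mVerts.2 ⟨e, h1, hv⟩) (mem_mVerts.2 ⟨e, h2, hv⟩)

lemma IsRainbowMatching.disjoint_mCols (hM : IsRainbowMatching fst snd col M)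
    {R₁ R₂ : Finset E} (h₁ : R₁ ⊆ M) (h₂ : R₂ ⊆ M) (h : Disjoint R₁ R₂) :
    Disjoint (mCols col R₁) (mCols col R₂) := by
  rw [Finset.disjoint_left]
  intro c hc1 hc2
  obtain ⟨e, he, rfl⟩ := mem_mCols.1 hc1
  obtain ⟨f, hf, hef⟩ := mem_mCols.1 hc2
  have := hM.2 f (h₂ hf) e (h₁ he) hef
  subst this
  exact Finset.disjoint_left.1 h he hf

lemma IsRainbowMatching.disjoint_mVerts (hM : IsRainbowMatching fst snd col M)
    {R₁ R₂ : Finset E} (h₁ : R₁ ⊆ M) (h₂ : R₂ ⊆ M) (h : Disjoint R₁ R₂) :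
    Disjoint (mVerts fst snd R₁) (mVerts fst snd R₂) := by
  rw [Finset.disjoint_left]
  intro c hc1 hc2
  obtain ⟨e, he, hce⟩ := mem_mVerts.1 hc1
  obtain ⟨f, hf, hcf⟩ := mem_mVerts.1 hc2
  have := hM.eq_of_mem (h₁ he) (h₂ hf) hce hcf
  subst this
  exact Finset.disjoint_left.1 h he hf

lemma Freeable.union (hM : IsRainbowMatching fst snd col M) (hC₀ : Disjoint C₀ (mCols col M))
    {S₁ S₂ X₁ X₂ : Finset V} {D₁ D₂ : Finset C} {s₁ s₂ : ℕ}
    (h₁ : Freeable fst snd col M C₀ P S₁ X₁ D₁ s₁)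
    (h₂ : Freeable fst snd col M C₀ P S₂ X₂ D₂ s₂) (hS : Disjoint S₁ S₂) :
    Freeable fst snd col M C₀ P (S₁ ∪ S₂) (X₁ ∪ X₂) (D₁ ∪ D₂) (s₁ + s₂) := by
  refine ⟨Finset.union_subset_union h₁.1 h₂.1, fun F Q hF hQ hF' hQ' => ?_⟩
  rw [Finset.card_union_of_disjoint hS] at hF'
  rw [Finset.disjoint_union_right] at hF
  obtain ⟨R₁, N₁, a1, a2, a3, a4, a5, a6, a7, a8, a9, a10, a11, a12, a13⟩ :=
    h₁.2 (F ∪ S₂) Q (Finset.disjoint_union_left.2 ⟨hF.1, hS.symm⟩) hQ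
      (by have := Finset.card_union_le F S₂; omega) (by omega)
  have hN₁ := card_mVerts_le (fst := fst) (snd := snd) N₁
  rw [Finset.disjoint_union_right] at a9
  have hN₁' : (mCols col N₁).card ≤ N₁.card := Finset.card_image_le
  obtain ⟨R₂, N₂, b1, b2, b3, b4, b5, b6, b7, b8, b9, b10, b11, b12, b13⟩ :=
    h₂.2 (F ∪ S₁ ∪ mVerts fst snd N₁) (Q ∪ mCols col N₁ ∩ C₀)
      (Finset.disjoint_union_left.2 ⟨Finset.disjoint_union_left.2 ⟨hF.2, hS⟩, a9.2⟩)
      (Finset.union_subset hQ Finset.inter_subset_right)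
      (by
        have h1 := Finset.card_union_le F S₁
        have h2 := Finset.card_union_le (F ∪ S₁) (mVerts fst snd N₁)
        omega)
      (by
        have h1 := Finset.card_union_le Q (mCols col N₁ ∩ C₀)
        have h2 := Finset.card_le_card (Finset.inter_subset_left : mCols col N₁ ∩ C₀ ⊆ mCols col N₁)
        omega)
  rw [Finset.disjoint_union_right, Finset.disjoint_union_right] at b9
  rw [Finset.disjoint_union_right] at b13
  have hRV : Disjoint (mVerts fst snd R₁) (mVerts fst snd R₂) := hS.mono a5 b5
  have hR := disjoint_of_mVerts hRV
  have hRC := hM.disjoint_mCols a1 b1 hR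
  have hR1C : Disjoint C₀ (mCols col R₁) := hC₀.mono_right (mCols_mono a1)
  have hR2C : Disjoint C₀ (mCols col R₂) := hC₀.mono_right (mCols_mono b1)
  have hNC : Disjoint (mCols col N₁) (mCols col N₂) := by
    have hQ₂ := b13.2
    rw [Finset.disjoint_left] at *
    intro c hc1 hc2
    have := a11 hc1
    have := b11 hc2
    grind
  have hN : Disjoint N₁ N₂ := disjoint_of_mVerts b9.2.symm
  refine ⟨R₁ ∪ R₂, N₁ ∪ N₂, Finset.union_subset a1 b1, ?_, ?_, a4.union b4 b9.2.symm hNC, ?_⟩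
  · rw [Finset.card_union_of_disjoint hN, Finset.card_union_of_disjoint hR, a2, b2]
  · rw [Finset.card_union_of_disjoint hN]; omega
  simp only [mVerts_union, mCols_union, Finset.disjoint_union_left, Finset.disjoint_union_right]
  refine ⟨Finset.union_subset_union a5 b5, by grind, by grind,
    ⟨⟨a8, b9.1.2.mono_right h₁.1⟩, a9.2.mono_right h₂.1, b8⟩, ⟨a9.1, b9.1.1⟩,
    Finset.union_subset_union a10 b10, by grind, ⟨⟨a12, ?_⟩, ?_, b12⟩, a13, b13.1⟩
  · rw [Finset.disjoint_left] at *
    intro c hc hd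
    have := b11 hc
    have := a10 hd
    grind
  · rw [Finset.disjoint_left] at *
    intro c hc hd
    have := a11 hc
    have := b10 hd
    grind

lemma Freeable.insert_edge (hM : IsRainbowMatching fst snd col M)
    (hC₀ : Disjoint C₀ (mCols col M)) {S X : Finset V} {D : Finset C} {s : ℕ}
    (h : Freeable fst snd col M C₀ P S X D s) {m e : E} {x y v : V} (hm : m ∈ M) (hxy : x ≠ y)
    (hmxy : endpts fst snd m = {x, y}) (he : endpts fst snd e = {x, v}) (hv : v ∈ X)
    (hcol : col e ∈ D) (hS : Disjoint {x, y} S) :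
    Freeable fst snd col M C₀ P ({x, y} ∪ S) {y} {col m} (s + 1) := by
  refine ⟨by simp, fun F Q hF hQ hF' hQ' => ?_⟩
  rw [Finset.card_union_of_disjoint hS] at hF'
  rw [Finset.disjoint_union_right] at hF
  obtain ⟨R, N, a1, a2, a3, a4, a5, a6, a7, a8, a9, a10, a11, a12, a13⟩ :=
    h.2 (F ∪ {x, y}) Q (Finset.disjoint_union_left.2 ⟨hF.2, hS⟩) hQ
      (by have := Finset.card_union_le F {x, y}; omega) (by omega)
  have hvS := h.1 hv
  have hx : x ∉ S := fun h' => Finset.disjoint_left.1 hS (by simp) h'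
  have hy : y ∉ S := fun h' => Finset.disjoint_left.1 hS (by simp) h'
  have hmR : m ∉ R := fun h' => hx (a5 (mem_mVerts.2 ⟨m, h', by simp [hmxy]⟩))
  have hxN : x ∉ mVerts fst snd N := fun h' => Finset.disjoint_left.1 a9 h' (by simp)
  have hyN : y ∉ mVerts fst snd N := fun h' => Finset.disjoint_left.1 a9 h' (by simp)
  have hvN : v ∉ mVerts fst snd N := fun h' => Finset.disjoint_left.1 a8 h' hv
  have hdN : col e ∉ mCols col N := fun h' => Finset.disjoint_left.1 a12 h' hcol
  have heN : e ∉ N := fun h' => hxN (mem_mVerts.2 ⟨e, h', by simp [he]⟩)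
  have hmC : col m ∉ mCols col R := by
    intro h'
    obtain ⟨f, hf, hfm⟩ := mem_mCols.1 h'
    exact hmR (hM.2 f (a1 hf) m hm hfm ▸ hf)
  have hmC0 : col m ∉ C₀ := fun h' =>
    Finset.disjoint_left.1 hC₀ h' (mem_mCols.2 ⟨m, hm, rfl⟩)
  have heR := a10 hcol
  have heC0 : col e ∉ C₀ := fun h' => Finset.disjoint_left.1 hC₀ h' (mCols_mono a1 heR)
  have hne : col e ≠ col m := fun h' => hmC (h' ▸ heR)
  have hmN : col m ∉ mCols col N := fun h' => by
    have := a11 h'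
    simp [hmC, hmC0] at this
  refine ⟨{m} ∪ R, {e} ∪ N, ?_, ?_, ?_, (isRainbowMatching_singleton e).union a4 ?_ ?_, ?_⟩
  · grind
  · rw [Finset.card_union_of_disjoint (by simpa), Finset.card_union_of_disjoint (by simpa)]
    simp [a2]
  · rw [Finset.card_union_of_disjoint (by simpa)]
    simp; omega
  · rw [mVerts_singleton, he]; simp [hxN, hvN]
  · rw [mCols_singleton]; simpa
  simp only [mVerts_union, mCols_union, mVerts_singleton, mCols_singleton, he, hmxy]
  have hxF : x ∉ F := fun h' => Finset.disjoint_left.1 hF.1 h' (by simp)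
  have hvF : v ∉ F := fun h' => Finset.disjoint_left.1 hF.2 h' hvS
  have hvy : v ≠ y := fun h' => hy (h' ▸ hvS)
  have hvRM := a6 hv
  have hym : y ∈ mVerts fst snd M := mem_mVerts.2 ⟨m, hm, by simp [hmxy]⟩
  refine ⟨by grind, by grind, by grind, ?_, ?_, by grind, by grind, ?_, ?_⟩
  · simp [hxy.symm, hvy.symm, hyN]
  · simp only [Finset.disjoint_union_left] at a9 ⊢
    refine ⟨by simp [hxF, hvF], (Finset.disjoint_union_right.1 a9).1⟩
  · simp [hne.symm, hmN]
  · simp only [Finset.disjoint_union_left, a13, and_true, Finset.disjoint_singleton_left]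
    exact fun h' => heC0 (hQ h')

lemma freeable_of_forall_exists_edge (hC₀ : Disjoint C₀ (mCols col M)) {H : Finset V}
    {m : E} {x y : V} (hm : m ∈ M) (hxy : x ≠ y) (hmxy : endpts fst snd m = {x, y})
    (h : ∀ (F : Finset V) (Q : Finset C), Disjoint F H → F.card ≤ P → Q.card ≤ P →
      ∃ e v, endpts fst snd e = {x, v} ∧ v ∉ mVerts fst snd M ∧ v ∉ F ∧ col e ∈ C₀ ∧ col e ∉ Q) :
    Freeable fst snd col M C₀ P ({x, y} ∪ H) {y} {col m} 1 := by
  refine ⟨by simp, fun F Q hF hQ hF' hQ' => ?_⟩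
  rw [Finset.disjoint_union_right] at hF
  obtain ⟨e, v, he, hvM, hvF, heC, heQ⟩ := h F Q hF.2 (by omega) (by omega)
  have hxF : x ∉ F := fun h' => Finset.disjoint_left.1 hF.1 h' (by simp)
  have hym : y ∈ mVerts fst snd M := mem_mVerts.2 ⟨m, hm, by simp [hmxy]⟩
  have hvy : v ≠ y := fun h' => hvM (h' ▸ hym)
  have hmC0 : col m ∉ C₀ := fun h' =>
    Finset.disjoint_left.1 hC₀ h' (mem_mCols.2 ⟨m, hm, rfl⟩)
  have hne : col e ≠ col m := fun h' => hmC0 (h' ▸ heC)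
  refine ⟨{m}, {e}, by simpa, by simp, by simp, isRainbowMatching_singleton e, ?_⟩
  simp only [mVerts_singleton, mCols_singleton, he, hmxy]
  clear h
  refine ⟨by grind, by grind, by simp [Finset.insert_subset_iff, hvM], ?_, ?_, by grind, by grind,
    ?_, ?_⟩
  · simp [hxy.symm, hvy.symm]
  · simp [hxF, hvF]
  · simp [hne]
  · simp [heQ]

lemma Freeable.exists_larger (hM : IsRainbowMatching fst snd col M)
    (hC₀ : Disjoint C₀ (mCols col M)) {S X : Finset V} {D : Finset C} {s : ℕ}
    (h : Freeable fst snd col M C₀ P S X D s) (hP : S.card + 2 * s ≤ P) {e : E}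
    (he : endpts fst snd e ⊆ X) (hcol : col e ∈ D) :
    ∃ M', IsRainbowMatching fst snd col M' ∧ M'.card = M.card + 1 := by
  obtain ⟨R, N, a1, a2, a3, a4, a5, a6, a7, a8, a9, a10, a11, a12, a13⟩ :=
    h.2 ∅ ∅ (by simp) (by simp) (by simpa using hP) (by simp; omega)
  have hMR : M \ R ⊆ M := Finset.sdiff_subset
  have hV : Disjoint (mVerts fst snd (M \ R)) (mVerts fst snd R) :=
    hM.disjoint_mVerts hMR a1 Finset.sdiff_disjoint
  have hC : Disjoint (mCols col (M \ R)) (mCols col R) :=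
    hM.disjoint_mCols hMR a1 Finset.sdiff_disjoint
  have hC' : Disjoint (mCols col (M \ R)) C₀ := (hC₀.mono_right (mCols_mono hMR)).symm
  have hV' : Disjoint (mVerts fst snd (M \ R)) (mVerts fst snd M)ᶜ :=
    disjoint_compl_right.mono_left (mVerts_mono hMR)
  have hV2 : Disjoint (mVerts fst snd (M \ R)) (mVerts fst snd R ∪ (mVerts fst snd M)ᶜ) :=
    Finset.disjoint_union_right.2 ⟨hV, hV'⟩
  have h1 := hV2.mono_right a7
  have h2 := hV2.mono_right (he.trans a6)
  have h3 : Disjoint (mVerts fst snd N) (endpts fst snd e) := a8.mono_right he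
  have h4 : Disjoint (mVerts fst snd ((M \ R) ∪ N)) (mVerts fst snd {e}) := by
    rw [mVerts_union, mVerts_singleton]; exact Finset.disjoint_union_left.2 ⟨h2, h3⟩
  refine ⟨((M \ R) ∪ N) ∪ {e}, ((hM.mono hMR).union a4 h1 ?_).union
    (isRainbowMatching_singleton e) h4 ?_, ?_⟩
  · exact (Finset.disjoint_union_right.2 ⟨hC, hC'⟩).mono_right a11
  · rw [mCols_union, mCols_singleton, Finset.disjoint_union_left]
    simp only [Finset.disjoint_singleton_right]
    exact ⟨fun h' => Finset.disjoint_left.1 hC h' (a10 hcol),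
      fun h' => Finset.disjoint_left.1 a12 h' hcol⟩
  · rw [Finset.card_union_of_disjoint (disjoint_of_mVerts h4),
      Finset.card_union_of_disjoint (disjoint_of_mVerts h1), Finset.card_sdiff_of_subset a1, a2,
      Finset.card_singleton]
    have := Finset.card_le_card a1
    omega

end Freeing

section Systems

variable {V E C : Type*} [Fintype V] [DecidableEq V] [Fintype E] [DecidableEq E] [DecidableEq C]
  {fst snd : E → V} {col : E → C} {M : Finset E} {C₀ : Finset C} {P : ℕ}

lemma sum_card_endpts_inter_le
    (hp : ∀ e f v, v ∈ endpts fst snd e → v ∈ endpts fst snd f → col e = col f → e = f)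
    (c : C) (Z : Finset V) :
    ∑ e with col e = c, (endpts fst snd e ∩ Z).card ≤ Z.card := by
  rw [← Finset.card_biUnion]
  · exact Finset.card_le_card (Finset.biUnion_subset.2 fun e _ => Finset.inter_subset_right)
  · intro e he f hf hne
    refine Finset.disjoint_left.2 fun v hv hv' => ?_
    simp only [Finset.coe_filter, Finset.mem_univ, true_and, Set.mem_ofPred_eq] at he hf
    exact hne (hp e f v (Finset.mem_inter.1 hv).1 (Finset.mem_inter.1 hv').1 (he.trans hf.symm))

lemma card_colour_meets_le
    (hp : ∀ e f v, v ∈ endpts fst snd e → v ∈ endpts fst snd f → col e = col f → e = f)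
    (c : C) (Z : Finset V) :
    (Finset.univ.filter fun e : E => col e = c ∧ ∃ v ∈ Z, v ∈ endpts fst snd e).card ≤ Z.card := by
  refine le_trans ?_ (sum_card_endpts_inter_le hp c Z)
  rw [← Finset.filter_filter, Finset.card_filter]
  refine Finset.sum_le_sum fun e _ => ?_
  split_ifs with h
  · obtain ⟨v, hv, hve⟩ := h
    exact Finset.card_pos.2 ⟨v, Finset.mem_inter.2 ⟨hve, hv⟩⟩
  · exact Nat.zero_le _

lemma two_mul_card_colour_le (hloop : ∀ e : E, fst e ≠ snd e)
    (hp : ∀ e f v, v ∈ endpts fst snd e → v ∈ endpts fst snd f → col e = col f → e = f)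
    {W X U : Finset V} (hW : ∀ v, v ∈ W ∨ v ∈ X ∨ v ∈ U) (c : C) :
    2 * (Finset.univ.filter fun e : E => col e = c).card ≤ 2 * X.card + U.card +
      (Finset.univ.filter fun e : E =>
        col e = c ∧ ∃ x ∈ U, ∃ v ∈ W, endpts fst snd e = {x, v}).card +
      2 * (Finset.univ.filter fun e : E => col e = c ∧ endpts fst snd e ⊆ W).card := by
  have hX := sum_card_endpts_inter_le hp c X
  have hU := sum_card_endpts_inter_le hp c U
  have key : ∑ e with col e = c, 2 ≤ ∑ e with col e = c, (2 * (endpts fst snd e ∩ X).card +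
      (endpts fst snd e ∩ U).card + (if ∃ x ∈ U, ∃ v ∈ W, endpts fst snd e = {x, v} then 1 else 0)
      + 2 * (if endpts fst snd e ⊆ W then 1 else 0)) := by
    refine Finset.sum_le_sum fun e _ => ?_
    by_cases h1 : (endpts fst snd e ∩ X).Nonempty
    · have := h1.card_pos
      omega
    have hX' : ∀ v ∈ endpts fst snd e, v ∈ W ∨ v ∈ U := by
      intro v hv
      have : v ∉ X := fun h => h1 ⟨v, Finset.mem_inter.2 ⟨hv, h⟩⟩
      have := hW v
      tauto
    by_cases h2 : endpts fst snd e ⊆ W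
    · simp [h2]
    by_cases h3 : endpts fst snd e ⊆ U
    · rw [Finset.inter_eq_left.2 h3]
      have : (endpts fst snd e).card = 2 := Finset.card_pair (hloop e)
      omega
    have h4 : ∃ x ∈ U, ∃ v ∈ W, endpts fst snd e = {x, v} := by
      have ha := hX' (fst e) (by simp [endpts])
      have hb := hX' (snd e) (by simp [endpts])
      simp only [endpts, Finset.insert_subset_iff, Finset.singleton_subset_iff] at h2 h3
      by_cases hf : fst e ∈ U
      · exact ⟨fst e, hf, snd e, by tauto, rfl⟩
      · exact ⟨snd e, by tauto, fst e, by tauto, Finset.pair_comm _ _⟩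
    obtain ⟨x, hx, v, hv, he⟩ := h4
    have : 0 < (endpts fst snd e ∩ U).card :=
      Finset.card_pos.2 ⟨x, Finset.mem_inter.2 ⟨by simp [he], hx⟩⟩
    rw [if_pos ⟨x, hx, v, hv, he⟩]
    omega
  simp only [Finset.sum_add_distrib, ← Finset.mul_sum, ← Finset.card_filter,
    Finset.filter_filter] at key
  simp only [Finset.sum_const, smul_eq_mul] at key
  omega

lemma exists_endpts_eq (hloop : ∀ e : E, fst e ≠ snd e) {m : E} {x : V}
    (hx : x ∈ endpts fst snd m) : ∃ z, x ≠ z ∧ endpts fst snd m = {x, z} := by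
  simp only [endpts, Finset.mem_insert, Finset.mem_singleton] at hx
  rcases hx with rfl | rfl
  · exact ⟨snd m, hloop m, rfl⟩
  · exact ⟨fst m, (hloop m).symm, Finset.pair_comm _ _⟩

lemma IsRainbowMatching.card_mVerts (hM : IsRainbowMatching fst snd col M)
    (hloop : ∀ e : E, fst e ≠ snd e) {R : Finset E} (hR : R ⊆ M) :
    (mVerts fst snd R).card = 2 * R.card := by
  rw [mVerts, Finset.card_biUnion, mul_comm]
  · exact Finset.sum_const_nat fun e _ => Finset.card_pair (hloop e)
  · intro e he f hf hne
    exact Finset.disjoint_iff_inter_eq_empty.2 (hM.1 e (hR he) f (hR hf) hne)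

/-- A set `A` of edges of the rainbow matching `M`, each `m ∈ A` with an endpoint `y m` that can be
freed together with the colour of `m`, with support `S m` and cost `s`. Supports have at most `σ`
vertices and every vertex lies in at most `t` of them. -/
structure IsSystem (fst snd : E → V) (col : E → C) (M : Finset E) (C₀ : Finset C) (P : ℕ)
    (A : Finset E) (y : E → V) (S : E → Finset V) (s σ t : ℕ) : Prop where
  subset : A ⊆ M
  mem_endpts : ∀ m ∈ A, y m ∈ endpts fst snd m
  freeable : ∀ m ∈ A, Freeable fst snd col M C₀ P (S m) {y m} {col m} s
  card_le : ∀ m ∈ A, (S m).card ≤ σ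
  support_subset : ∀ m ∈ A, S m ⊆ mVerts fst snd A ∪ (mVerts fst snd M)ᶜ
  load_le : ∀ f, (A.filter fun m => f ∈ S m).card ≤ t

/-- The vertices that a system can free: the chosen endpoints and the uncovered vertices. -/
def freeVerts (fst snd : E → V) (M A : Finset E) (y : E → V) : Finset V :=
  A.image y ∪ (mVerts fst snd M)ᶜ

lemma IsSystem.injOn (hM : IsRainbowMatching fst snd col M) {A : Finset E} {y : E → V}
    {S : E → Finset V} {s σ t : ℕ} (h : IsSystem fst snd col M C₀ P A y S s σ t) :
    Set.InjOn y A := by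
  intro m hm m' hm' hy
  exact hM.eq_of_mem (h.subset hm) (h.subset hm') (h.mem_endpts m hm)
    (hy ▸ h.mem_endpts m' hm')

/-- `T` assigns supports to all vertices a system can free. -/
structure IsVertexSupport (fst snd : E → V) (col : E → C) (M : Finset E) (C₀ : Finset C) (P : ℕ)
    (A : Finset E) (y : E → V) (S : E → Finset V) (s σ t : ℕ) (T : V → Finset V) : Prop where
  apply_eq : ∀ m ∈ A, T (y m) = S m
  apply_eq_singleton : ∀ u, u ∉ mVerts fst snd M → T u = {u}
  freeable : ∀ u ∈ freeVerts fst snd M A y, Freeable fst snd col M C₀ P (T u) {u} ∅ s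
  card_le : ∀ u ∈ freeVerts fst snd M A y, (T u).card ≤ σ
  support_subset : ∀ u ∈ freeVerts fst snd M A y, T u ⊆ mVerts fst snd A ∪ (mVerts fst snd M)ᶜ
  load_le : ∀ f, ((freeVerts fst snd M A y).filter fun u => f ∈ T u).card ≤ t + 1

lemma IsSystem.exists_isVertexSupport (hM : IsRainbowMatching fst snd col M) {A : Finset E}
    {y : E → V} {S : E → Finset V} {s σ t : ℕ}
    (h : IsSystem fst snd col M C₀ P A y S s σ t) (hσ : 1 ≤ σ) :
    ∃ T, IsVertexSupport fst snd col M C₀ P A y S s σ t T := by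
  classical
  let T : V → Finset V := fun u => if hu : ∃ m ∈ A, y m = u then S hu.choose else {u}
  have hT1 : ∀ m ∈ A, T (y m) = S m := by
    intro m hm
    have hu : ∃ m' ∈ A, y m' = y m := ⟨m, hm, rfl⟩
    have : hu.choose = m := h.injOn hM hu.choose_spec.1 hm hu.choose_spec.2
    simp only [T]
    rw [dif_pos hu, this]
  have hT2 : ∀ u, u ∉ mVerts fst snd M → T u = {u} := by
    intro u hu
    have : ¬ ∃ m ∈ A, y m = u := by
      rintro ⟨m, hm, rfl⟩
      exact hu (mem_mVerts.2 ⟨m, h.subset hm, h.mem_endpts m hm⟩)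
    simp only [T]
    rw [dif_neg this]
  have hW : ∀ u ∈ freeVerts fst snd M A y, (∃ m ∈ A, y m = u) ∨ u ∉ mVerts fst snd M := by
    intro u hu
    simpa [freeVerts] using hu
  refine ⟨T, hT1, hT2, ?_, ?_, ?_, ?_⟩
  · intro u hu
    rcases hW u hu with ⟨m, hm, rfl⟩ | hu
    · rw [hT1 m hm]; exact (h.freeable m hm).mono (by simp) le_rfl
    · rw [hT2 u hu]; exact (freeable_of_notMem hu).mono le_rfl (Nat.zero_le _)
  · intro u hu
    rcases hW u hu with ⟨m, hm, rfl⟩ | hu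
    · rw [hT1 m hm]; exact h.card_le m hm
    · rw [hT2 u hu]; simpa
  · intro u hu
    rcases hW u hu with ⟨m, hm, rfl⟩ | hu
    · rw [hT1 m hm]; exact h.support_subset m hm
    · rw [hT2 u hu]; simp [hu]
  · intro f
    have : (freeVerts fst snd M A y).filter (fun u => f ∈ T u) ⊆
        (A.filter fun m => f ∈ S m).image y ∪ {f} := by
      intro u hu
      obtain ⟨hu, hf⟩ := Finset.mem_filter.1 hu
      rcases hW u hu with ⟨m, hm, rfl⟩ | hu
      · rw [hT1 m hm] at hf
        exact Finset.mem_union_left _ (Finset.mem_image.2 ⟨m, Finset.mem_filter.2 ⟨hm, hf⟩, rfl⟩)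
      · rw [hT2 u hu] at hf
        simp_all
    refine (Finset.card_le_card this).trans ((Finset.card_union_le _ _).trans ?_)
    have h1 : ((A.filter fun m => f ∈ S m).image y).card ≤ _ := Finset.card_image_le
    have h2 := h.load_le f
    simp only [Finset.card_singleton]
    omega

lemma IsVertexSupport.card_not_disjoint_le {A : Finset E} {y : E → V} {S : E → Finset V}
    {s σ t : ℕ} {T : V → Finset V} (hT : IsVertexSupport fst snd col M C₀ P A y S s σ t T)
    (Z : Finset V) :
    ((freeVerts fst snd M A y).filter fun u => ¬ Disjoint (T u) Z).card ≤ Z.card * (t + 1) := by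
  have : (freeVerts fst snd M A y).filter (fun u => ¬ Disjoint (T u) Z) ⊆
      Z.biUnion fun f => (freeVerts fst snd M A y).filter fun u => f ∈ T u := by
    intro u hu
    obtain ⟨hu, hd⟩ := Finset.mem_filter.1 hu
    obtain ⟨f, hf, hfZ⟩ := Finset.not_disjoint_iff.1 hd
    exact Finset.mem_biUnion.2 ⟨f, hfZ, Finset.mem_filter.2 ⟨hu, hf⟩⟩
  exact (Finset.card_le_card this).trans
    (Finset.card_biUnion_le_card_mul _ _ _ fun f _ => hT.load_le f)

lemma IsSystem.adjoin (hM : IsRainbowMatching fst snd col M) (hC₀ : Disjoint C₀ (mCols col M))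
    {A : Finset E} {y : E → V} {S : E → Finset V} {s σ t : ℕ} {T : V → Finset V}
    (h : IsSystem fst snd col M C₀ P A y S s σ t)
    (hT : IsVertexSupport fst snd col M C₀ P A y S s σ t T)
    {B : Finset E} {m a : E → E} {x z v : E → V}
    (hm : ∀ e ∈ B, m e ∈ M ∧ m e ∉ A) (ha : ∀ e ∈ B, a e ∈ A) (hxz : ∀ e ∈ B, x e ≠ z e)
    (hmxz : ∀ e ∈ B, endpts fst snd (m e) = {x e, z e})
    (hxv : ∀ e ∈ B, endpts fst snd e = {x e, v e})
    (hv : ∀ e ∈ B, v e ∈ freeVerts fst snd M A y) (hcol : ∀ e ∈ B, col e = col (a e))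
    (hdisj : ∀ e ∈ B, Disjoint (T (v e)) (S (a e)))
    (hmi : Set.InjOn m B) (hvi : Set.InjOn v B) (hai : Set.InjOn a B) :
    ∃ A' y' S', IsSystem fst snd col M C₀ P A' y' S' (2 * s + 1) (2 * σ + 2) (3 * t + 2) ∧
      A'.card = A.card + B.card := by
  classical
  let g : E → E := fun f => if hf : ∃ e ∈ B, m e = f then hf.choose else f
  have hg : ∀ e ∈ B, g (m e) = e := by
    intro e he
    have hf : ∃ e' ∈ B, m e' = m e := ⟨e, he, rfl⟩
    have := hmi hf.choose_spec.1 he hf.choose_spec.2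
    simp only [g]
    rw [dif_pos hf, this]
  let S₁ : E → Finset V := fun e => {x e, z e} ∪ (T (v e) ∪ S (a e))
  let y' : E → V := fun f => if f ∈ A then y f else z (g f)
  let S' : E → Finset V := fun f => if f ∈ A then S f else S₁ (g f)
  have hyA : ∀ f ∈ A, y' f = y f := fun f hf => if_pos hf
  have hSA : ∀ f ∈ A, S' f = S f := fun f hf => if_pos hf
  have hyB : ∀ e ∈ B, y' (m e) = z e := by
    intro e he
    simp only [y']
    rw [if_neg (hm e he).2, hg e he]
  have hSB : ∀ e ∈ B, S' (m e) = S₁ e := by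
    intro e he
    simp only [S']
    rw [if_neg (hm e he).2, hg e he]
  have hmem : ∀ f ∈ A ∪ B.image m, f ∈ A ∨ ∃ e ∈ B, m e = f := by
    intro f hf
    simpa using hf
  have hAA' : mVerts fst snd A ⊆ mVerts fst snd (A ∪ B.image m) :=
    mVerts_mono Finset.subset_union_left
  have hsub : ∀ e ∈ B, T (v e) ∪ S (a e) ⊆ mVerts fst snd A ∪ (mVerts fst snd M)ᶜ :=
    fun e he => Finset.union_subset (hT.support_subset _ (hv e he))
      (h.support_subset _ (ha e he))
  have hd : ∀ e ∈ B, Disjoint {x e, z e} (T (v e) ∪ S (a e)) := by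
    intro e he
    rw [← hmxz e he]
    refine Disjoint.mono_right (hsub e he) ?_
    rw [Finset.disjoint_left]
    intro w hw hw'
    rcases Finset.mem_union.1 hw' with hw' | hw'
    · obtain ⟨f, hf, hwf⟩ := mem_mVerts.1 hw'
      have := hM.eq_of_mem (hm e he).1 (h.subset hf) hw hwf
      exact (hm e he).2 (this ▸ hf)
    · exact Finset.mem_compl.1 hw' (mem_mVerts.2 ⟨m e, (hm e he).1, hw⟩)
  refine ⟨A ∪ B.image m, y', S', ⟨?_, ?_, ?_, ?_, ?_, ?_⟩, ?_⟩
  · refine Finset.union_subset h.subset ?_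
    intro f hf
    obtain ⟨e, he, rfl⟩ := Finset.mem_image.1 hf
    exact (hm e he).1
  · intro f hf
    rcases hmem f hf with hf | ⟨e, he, rfl⟩
    · rw [hyA f hf]; exact h.mem_endpts f hf
    · rw [hyB e he, hmxz e he]; simp
  · intro f hf
    rcases hmem f hf with hf | ⟨e, he, rfl⟩
    · rw [hyA f hf, hSA f hf]; exact (h.freeable f hf).mono subset_rfl (by omega)
    · rw [hyB e he, hSB e he]
      have h1 := (hT.freeable _ (hv e he)).union hM hC₀ (h.freeable _ (ha e he)) (hdisj e he)
      exact (h1.insert_edge hM hC₀ (hm e he).1 (hxz e he) (hmxz e he) (hxv e he) (by simp)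
        (by simp [hcol e he]) (hd e he)).mono subset_rfl (by omega)
  · intro f hf
    rcases hmem f hf with hf | ⟨e, he, rfl⟩
    · rw [hSA f hf]; have := h.card_le f hf; omega
    · rw [hSB e he]
      have h1 := Finset.card_union_le {x e, z e} (T (v e) ∪ S (a e))
      have h2 := Finset.card_union_le (T (v e)) (S (a e))
      have h3 := hT.card_le _ (hv e he)
      have h4 := h.card_le _ (ha e he)
      have h5 : ({x e, z e} : Finset V).card ≤ 2 := Finset.card_le_two
      simp only [S₁]
      omega
  · intro f hf
    rcases hmem f hf with hf | ⟨e, he, rfl⟩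
    · rw [hSA f hf]
      exact (h.support_subset f hf).trans (Finset.union_subset_union_left hAA')
    · rw [hSB e he]
      refine Finset.union_subset ?_ ((hsub e he).trans (Finset.union_subset_union_left hAA'))
      rw [← hmxz e he]
      intro w hw
      exact Finset.mem_union_left _ (mem_mVerts.2 ⟨m e, hf, hw⟩)
  · intro f
    have hsub' : (A ∪ B.image m).filter (fun k => f ∈ S' k) ⊆ (A.filter fun k => f ∈ S k) ∪
        ((B.filter fun e => f ∈ endpts fst snd (m e)) ∪ ((B.filter fun e => f ∈ T (v e)) ∪
          (B.filter fun e => f ∈ S (a e)))).image m := by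
      intro k hk
      obtain ⟨hk, hf⟩ := Finset.mem_filter.1 hk
      rcases hmem k hk with hk | ⟨e, he, rfl⟩
      · rw [hSA k hk] at hf
        exact Finset.mem_union_left _ (Finset.mem_filter.2 ⟨hk, hf⟩)
      · rw [hSB e he] at hf
        refine Finset.mem_union_right _ (Finset.mem_image.2 ⟨e, ?_, rfl⟩)
        simp only [S₁, ← hmxz e he, Finset.mem_union] at hf
        simp only [Finset.mem_union, Finset.mem_filter, he, true_and]
        exact hf
    have h1 : (B.filter fun e => f ∈ endpts fst snd (m e)).card ≤ 1 := by
      refine Finset.card_le_one.2 fun e he e' he' => ?_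
      obtain ⟨he, hf⟩ := Finset.mem_filter.1 he
      obtain ⟨he', hf'⟩ := Finset.mem_filter.1 he'
      exact hmi he he' (hM.eq_of_mem (hm e he).1 (hm e' he').1 hf hf')
    have h2 : (B.filter fun e => f ∈ T (v e)).card ≤ t + 1 := by
      refine le_trans ?_ (hT.load_le f)
      refine Finset.card_le_card_of_injOn v ?_
        (hvi.mono (Finset.coe_subset.2 (Finset.filter_subset _ _)))
      intro e he
      simp only [Finset.coe_filter, Set.mem_ofPred_eq] at he ⊢
      exact ⟨hv e he.1, he.2⟩
    have h3 : (B.filter fun e => f ∈ S (a e)).card ≤ t := by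
      refine le_trans ?_ (h.load_le f)
      refine Finset.card_le_card_of_injOn a ?_
        (hai.mono (Finset.coe_subset.2 (Finset.filter_subset _ _)))
      intro e he
      simp only [Finset.coe_filter, Set.mem_ofPred_eq] at he ⊢
      exact ⟨ha e he.1, he.2⟩
    have h4 := h.load_le f
    refine (Finset.card_le_card hsub').trans ((Finset.card_union_le _ _).trans ?_)
    refine (Nat.add_le_add_left (Finset.card_image_le.trans ((Finset.card_union_le _ _).trans
      (Nat.add_le_add_left (Finset.card_union_le _ _) _))) _).trans ?_
    omega
  · rw [Finset.card_union_of_disjoint, Finset.card_image_of_injOn hmi]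
    rw [Finset.disjoint_right]
    intro f hf
    obtain ⟨e, he, rfl⟩ := Finset.mem_image.1 hf
    exact (hm e he).2

end Systems

section Extension

lemma exists_injOn_of_greedy {E V : Type*} [DecidableEq E] {K G : Finset E} {m a : E → E}
    {v : E → V} {q : ℕ} (hq : q ≤ G.card)
    (h : ∀ B ⊆ K, B.card < q → ∀ g ∈ G, ∃ e ∈ K, a e = g ∧ ∀ b ∈ B, m e ≠ m b ∧ v e ≠ v b) :
    ∃ B ⊆ K, B.card = q ∧ Set.InjOn m B ∧ Set.InjOn v B ∧ Set.InjOn a B := by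
  suffices H : ∀ j ≤ q, ∃ B ⊆ K, B.card = j ∧ Set.InjOn m B ∧ Set.InjOn v B ∧ Set.InjOn a B from
    H q le_rfl
  intro j
  induction j with
  | zero => exact fun _ => ⟨∅, by simp⟩
  | succ j ih =>
    intro hj
    obtain ⟨B, hBK, hB, hm, hv, ha⟩ := ih (by omega)
    have hlt : (B.image a).card < G.card := lt_of_le_of_lt Finset.card_image_le (by omega)
    obtain ⟨g, hg, hga⟩ := Finset.exists_mem_notMem_of_card_lt_card hlt
    obtain ⟨e, heK, rfl, he⟩ := h B hBK (by omega) g hg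
    have heB : e ∉ B := fun h' => (he e h').1 rfl
    refine ⟨insert e B, Finset.insert_subset heK hBK, by rw [Finset.card_insert_of_notMem heB, hB],
      ?_⟩
    have heB' : e ∉ (B : Set E) := heB
    rw [Finset.coe_insert, Set.injOn_insert heB', Set.injOn_insert heB', Set.injOn_insert heB']
    refine ⟨⟨hm, ?_⟩, ⟨hv, ?_⟩, ha, ?_⟩
    · rintro ⟨b, hb, hbe⟩; exact (he b hb).1 hbe.symm
    · rintro ⟨b, hb, hbe⟩; exact (he b hb).2 hbe.symm
    · rintro ⟨b, hb, hbe⟩; exact hga (Finset.mem_image.2 ⟨b, hb, hbe⟩)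

variable {V E C : Type*} [Fintype V] [DecidableEq V] [Fintype E] [DecidableEq E] [DecidableEq C]
  {fst snd : E → V} {col : E → C} {M : Finset E} {C₀ : Finset C} {P : ℕ}
  {A : Finset E} {y : E → V} {S : E → Finset V} {s σ t : ℕ} {T : V → Finset V}

lemma IsVertexSupport.not_disjoint (hM : IsRainbowMatching fst snd col M)
    (hC₀ : Disjoint C₀ (mCols col M))
    (hmax : ∀ M', IsRainbowMatching fst snd col M' → M'.card ≤ M.card)
    (h : IsSystem fst snd col M C₀ P A y S s σ t)
    (hT : IsVertexSupport fst snd col M C₀ P A y S s σ t T) (hP : 3 * σ + 6 * s ≤ P)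
    {a e : E} {u v : V} (ha : a ∈ A) (hu : u ∈ freeVerts fst snd M A y)
    (hv : v ∈ freeVerts fst snd M A y) (he : endpts fst snd e = {u, v}) (hcol : col e = col a)
    (hua : Disjoint (T u) (S a)) (hva : Disjoint (T v) (S a)) : ¬ Disjoint (T u) (T v) := by
  intro huv
  have h1 := (hT.freeable u hu).union hM hC₀ (hT.freeable v hv) huv
  have h2 := h1.union hM hC₀ (h.freeable a ha) (Finset.disjoint_union_left.2 ⟨hua, hva⟩)
  obtain ⟨M', hM', hcard⟩ := h2.exists_larger hM hC₀ (e := e)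
    (by
      have := Finset.card_union_le (T u ∪ T v) (S a)
      have := Finset.card_union_le (T u) (T v)
      have := hT.card_le u hu
      have := hT.card_le v hv
      have := h.card_le a ha
      omega)
    (by rw [he]; intro w hw; simp at hw ⊢; tauto) (by simp [hcol])
  have := hmax M' hM'
  omega

lemma IsVertexSupport.sum_card_subset_le (hloop : ∀ e : E, fst e ≠ snd e)
    (hp : ∀ e f v, v ∈ endpts fst snd e → v ∈ endpts fst snd f → col e = col f → e = f)
    (hM : IsRainbowMatching fst snd col M) (hC₀ : Disjoint C₀ (mCols col M))
    (hmax : ∀ M', IsRainbowMatching fst snd col M' → M'.card ≤ M.card)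
    (h : IsSystem fst snd col M C₀ P A y S s σ t)
    (hT : IsVertexSupport fst snd col M C₀ P A y S s σ t T) (hP : 3 * σ + 6 * s ≤ P) {μ : ℕ}
    (hμ : ∀ u v : V, (Finset.univ.filter fun e : E => endpts fst snd e = {u, v}).card ≤ μ) :
    ∑ a ∈ A, (Finset.univ.filter fun e : E =>
      col e = col a ∧ endpts fst snd e ⊆ freeVerts fst snd M A y).card ≤
      A.card * (σ * (t + 1) * (1 + μ)) := by
  set W := freeVerts fst snd M A y with hW
  let Z : E → Finset V := fun a => W.filter fun u => ¬ Disjoint (T u) (S a)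
  have hZ : ∀ a ∈ A, (Z a).card ≤ σ * (t + 1) := fun a ha =>
    (hT.card_not_disjoint_le (S a)).trans (Nat.mul_le_mul_right _ (h.card_le a ha))
  let K : E → Finset E := fun a => Finset.univ.filter fun e : E =>
    col e = col a ∧ ∃ m ∈ A, ∃ v ∈ Z m, endpts fst snd e = {y m, v}
  have h1 : ∀ a ∈ A, (Finset.univ.filter fun e : E => col e = col a ∧ endpts fst snd e ⊆ W).card ≤
      σ * (t + 1) + (K a).card := by
    intro a ha
    have hsub : (Finset.univ.filter fun e : E => col e = col a ∧ endpts fst snd e ⊆ W) ⊆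
        (Finset.univ.filter fun e : E => col e = col a ∧ ∃ v ∈ Z a, v ∈ endpts fst snd e) ∪
          K a := by
      intro e he
      simp only [Finset.mem_filter, Finset.mem_univ, true_and] at he
      simp only [Finset.mem_union, Finset.mem_filter, Finset.mem_univ, true_and, K]
      by_cases hc : ∃ v ∈ Z a, v ∈ endpts fst snd e
      · exact Or.inl ⟨he.1, hc⟩
      refine Or.inr ⟨he.1, ?_⟩
      have hu : fst e ∈ W := he.2 (by simp [endpts])
      have hv : snd e ∈ W := he.2 (by simp [endpts])
      have hua : Disjoint (T (fst e)) (S a) := by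
        by_contra hd
        exact hc ⟨fst e, Finset.mem_filter.2 ⟨hu, hd⟩, by simp [endpts]⟩
      have hva : Disjoint (T (snd e)) (S a) := by
        by_contra hd
        exact hc ⟨snd e, Finset.mem_filter.2 ⟨hv, hd⟩, by simp [endpts]⟩
      have hd := hT.not_disjoint hM hC₀ hmax h hP ha hu hv rfl he.1 hua hva
      have hcase : ∀ w ∈ W, (∃ m ∈ A, y m = w) ∨ w ∉ mVerts fst snd M := by
        intro w hw
        simpa [hW, freeVerts] using hw
      rcases hcase _ hu with ⟨m, hm, hmu⟩ | hu'
      · refine ⟨m, hm, snd e, Finset.mem_filter.2 ⟨hv, ?_⟩, by rw [hmu]; rfl⟩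
        rw [← hT.apply_eq m hm, hmu, disjoint_comm]
        exact hd
      · rcases hcase _ hv with ⟨m, hm, hmv⟩ | hv'
        · refine ⟨m, hm, fst e, Finset.mem_filter.2 ⟨hu, ?_⟩, ?_⟩
          · rw [← hT.apply_eq m hm, hmv]
            exact hd
          · rw [hmv]; exact Finset.pair_comm _ _
        · rw [hT.apply_eq_singleton _ hu', hT.apply_eq_singleton _ hv'] at hd
          exact absurd (Finset.disjoint_singleton.2 (hloop e)) hd
    refine (Finset.card_le_card hsub).trans ((Finset.card_union_le _ _).trans ?_)
    exact Nat.add_le_add_right ((card_colour_meets_le hp _ _).trans (hZ a ha)) _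
  have h2 : ∑ a ∈ A, (K a).card ≤ A.card * (σ * (t + 1) * μ) := by
    rw [← Finset.card_biUnion]
    · have hsub : A.biUnion K ⊆ A.biUnion fun m => (Z m).biUnion fun v =>
          Finset.univ.filter fun e : E => endpts fst snd e = {y m, v} := by
        intro e he
        simp only [Finset.mem_biUnion, K, Finset.mem_filter, Finset.mem_univ, true_and] at he ⊢
        obtain ⟨a, -, -, m, hm, v, hv, he⟩ := he
        exact ⟨m, hm, v, hv, he⟩
      refine (Finset.card_le_card hsub).trans (Finset.card_biUnion_le_card_mul _ _ _ fun m hm => ?_)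
      exact (Finset.card_biUnion_le_card_mul _ _ μ fun v _ => hμ _ _).trans
        (Nat.mul_le_mul_right _ (hZ m hm))
    · intro a ha b hb hne
      refine Finset.disjoint_left.2 fun e he he' => hne ?_
      simp only [K, Finset.mem_filter] at he he'
      exact hM.2 a (h.subset ha) b (h.subset hb) (he.2.1.symm.trans he'.2.1)
  refine (Finset.sum_le_sum h1).trans ?_
  rw [Finset.sum_add_distrib, Finset.sum_const, smul_eq_mul]
  calc _ ≤ A.card * (σ * (t + 1)) + A.card * (σ * (t + 1) * μ) := Nat.add_le_add_left h2 _
    _ = _ := by ring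

lemma IsSystem.two_mul_card_colour_le (hloop : ∀ e : E, fst e ≠ snd e)
    (hp : ∀ e f v, v ∈ endpts fst snd e → v ∈ endpts fst snd f → col e = col f → e = f)
    (hM : IsRainbowMatching fst snd col M) (h : IsSystem fst snd col M C₀ P A y S s σ t) (c : C) :
    2 * (Finset.univ.filter fun e : E => col e = c).card ≤ 2 * M.card +
      (Finset.univ.filter fun e : E => col e = c ∧ ∃ x ∈ mVerts fst snd M \ mVerts fst snd A,
        ∃ v ∈ freeVerts fst snd M A y, endpts fst snd e = {x, v}).card +
      2 * (Finset.univ.filter fun e : E =>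
        col e = c ∧ endpts fst snd e ⊆ freeVerts fst snd M A y).card := by
  have hy : A.image y ⊆ mVerts fst snd A := by
    intro u hu
    obtain ⟨m, hm, rfl⟩ := Finset.mem_image.1 hu
    exact mem_mVerts.2 ⟨m, hm, h.mem_endpts m hm⟩
  have hX : (mVerts fst snd A \ A.image y).card = A.card := by
    rw [Finset.card_sdiff_of_subset hy, Finset.card_image_of_injOn (h.injOn hM),
      hM.card_mVerts hloop h.subset]
    omega
  have hU : (mVerts fst snd M \ mVerts fst snd A).card = 2 * M.card - 2 * A.card := by
    rw [Finset.card_sdiff_of_subset (mVerts_mono h.subset), hM.card_mVerts hloop h.subset,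
      hM.card_mVerts hloop subset_rfl]
  have := _root_.two_mul_card_colour_le hloop hp (W := freeVerts fst snd M A y)
    (X := mVerts fst snd A \ A.image y) (U := mVerts fst snd M \ mVerts fst snd A)
    (by
      intro v
      simp only [freeVerts, Finset.mem_union, Finset.mem_compl, Finset.mem_sdiff]
      tauto) c
  have := Finset.card_le_card h.subset
  omega

lemma IsSystem.extend (hloop : ∀ e : E, fst e ≠ snd e)
    (hp : ∀ e f v, v ∈ endpts fst snd e → v ∈ endpts fst snd f → col e = col f → e = f)
    (hM : IsRainbowMatching fst snd col M) (hC₀ : Disjoint C₀ (mCols col M))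
    (hmax : ∀ M', IsRainbowMatching fst snd col M' → M'.card ≤ M.card)
    (h : IsSystem fst snd col M C₀ P A y S s σ t) (hσ : 1 ≤ σ) (hP : 3 * σ + 6 * s ≤ P) {μ : ℕ}
    (hμ : ∀ u v : V, (Finset.univ.filter fun e : E => endpts fst snd e = {u, v}).card ≤ μ)
    {β : ℝ} (hβ : 0 < β)
    (hcard : ∀ c, M.card + β ≤ (Finset.univ.filter fun e : E => col e = c).card)
    (hA : β / 2 ≤ A.card) (hsmall : σ * (t + 1) * (1 + μ) ≤ β / 8) :
    ∃ A' y' S', IsSystem fst snd col M C₀ P A' y' S' (2 * s + 1) (2 * σ + 2) (3 * t + 2) ∧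
      A.card + β / 4 ≤ A'.card := by
  obtain ⟨T, hT⟩ := h.exists_isVertexSupport hM hσ
  set W := freeVerts fst snd M A y with hW
  set U := mVerts fst snd M \ mVerts fst snd A with hU
  let I : E → ℕ := fun a =>
    (Finset.univ.filter fun e : E => col e = col a ∧ endpts fst snd e ⊆ W).card
  let K : E → Finset E := fun a => Finset.univ.filter fun e : E =>
    col e = col a ∧ ∃ x ∈ U, ∃ v ∈ W, endpts fst snd e = {x, v}
  have hI : (∑ a ∈ A, (I a : ℝ)) ≤ A.card * (β / 8) := by
    have h1 : ∑ a ∈ A, I a ≤ _ := hT.sum_card_subset_le hloop hp hM hC₀ hmax h hP hμ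
    calc (∑ a ∈ A, (I a : ℝ)) ≤ A.card * (σ * (t + 1) * (1 + μ)) := by exact_mod_cast h1
      _ ≤ _ := by gcongr
  have hKI : ∀ a ∈ A, 2 * β ≤ (K a).card + 2 * I a := by
    intro a _
    have h1 : (2 * (Finset.univ.filter fun e : E => col e = col a).card : ℝ) ≤
        2 * M.card + (K a).card + 2 * I a := by
      exact_mod_cast h.two_mul_card_colour_le hloop hp hM (col a)
    have h2 := hcard (col a)
    linarith
  let G : Finset E := A.filter fun a => (I a : ℝ) ≤ β / 4
  have hG : β / 4 ≤ G.card := by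
    have h1 : (G.card : ℝ) + (A.filter fun a => ¬ (I a : ℝ) ≤ β / 4).card = A.card := by
      exact_mod_cast Finset.card_filter_add_card_filter_not (s := A) (fun a => (I a : ℝ) ≤ β / 4)
    have h2 : ((A.filter fun a => ¬ (I a : ℝ) ≤ β / 4).card : ℝ) * (β / 4) ≤ A.card * (β / 8) := by
      refine le_trans ?_ hI
      rw [← nsmul_eq_mul]
      refine (Finset.card_nsmul_le_sum _ (fun a => (I a : ℝ)) _ fun a ha => ?_).trans
        (Finset.sum_le_sum_of_subset_of_nonneg (Finset.filter_subset _ _) fun _ _ _ => by positivity)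
      exact (not_le.1 (Finset.mem_filter.1 ha).2).le
    have h3 : ((A.filter fun a => ¬ (I a : ℝ) ≤ β / 4).card : ℝ) ≤ A.card / 2 := by
      by_contra hlt
      have := not_le.1 hlt
      nlinarith
    linarith
  have hσt : (σ * (t + 1) : ℝ) ≤ β / 8 := by
    refine le_trans ?_ hsmall
    exact le_mul_of_one_le_right (by positivity) (by simp)
  let Z : E → Finset V := fun a => W.filter fun u => ¬ Disjoint (T u) (S a)
  have hZ : ∀ a ∈ A, ((Z a).card : ℝ) ≤ σ * (t + 1) := fun a ha => by
    exact_mod_cast (hT.card_not_disjoint_le (S a)).trans (Nat.mul_le_mul_right _ (h.card_le a ha))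
  let Q : Finset E := Finset.univ.filter fun e => ∃ m ∈ M \ A, ∃ x z v, ∃ a ∈ A, x ≠ z ∧
    endpts fst snd m = {x, z} ∧ endpts fst snd e = {x, v} ∧ v ∈ W ∧ col e = col a ∧
      Disjoint (T v) (S a)
  have hQ : ∀ e ∈ Q, ∃ m, ∃ x z v, ∃ a, m ∈ M \ A ∧ a ∈ A ∧ x ≠ z ∧
    endpts fst snd m = {x, z} ∧ endpts fst snd e = {x, v} ∧ v ∈ W ∧ col e = col a ∧
      Disjoint (T v) (S a) := by
    intro e he
    obtain ⟨m, hm, x, z, v, a, ha, h'⟩ := (Finset.mem_filter.1 he).2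
    exact ⟨m, x, z, v, a, hm, ha, h'⟩
  obtain ⟨e₀, -⟩ : A.Nonempty := Finset.card_pos.1 (by exact_mod_cast (half_pos hβ).trans_le hA)
  have : Nonempty E := ⟨e₀⟩
  have : Nonempty V := ⟨fst e₀⟩
  choose! m x z v a hm ha hxz hmxz hxv hv hcol hdisj using hQ
  obtain ⟨B, hBQ, hB, hmi, hvi, hai⟩ := exists_injOn_of_greedy (K := Q) (G := G) (m := m) (a := a)
    (v := v) (q := ⌈β / 4⌉₊) (Nat.ceil_le.2 hG) (by
      intro B hB hBq g hg
      have hBq' := Nat.lt_ceil.1 hBq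
      obtain ⟨hgA, hgI⟩ := Finset.mem_filter.1 hg
      let Y : Finset V := Z g ∪ (B.image v ∪ mVerts fst snd (B.image m))
      have hY : (Y.card : ℝ) < (K g).card := by
        have h1 : (Y.card : ℝ) ≤ (Z g).card + (B.card + 2 * B.card) := by
          have h1 := Finset.card_union_le (Z g) (B.image v ∪ mVerts fst snd (B.image m))
          have h2 := Finset.card_union_le (B.image v) (mVerts fst snd (B.image m))
          have h3 := card_mVerts_le (fst := fst) (snd := snd) (B.image m)
          have h4 : (B.image m).card ≤ B.card := Finset.card_image_le
          have h5 : (B.image v).card ≤ B.card := Finset.card_image_le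
          have : Y.card ≤ (Z g).card + (B.card + 2 * B.card) := by simp only [Y]; omega
          exact_mod_cast this
        have h2 := hZ g hgA
        have h3 := hKI g hgA
        linarith
      have hY' : (Finset.univ.filter fun e : E =>
          col e = col g ∧ ∃ w ∈ Y, w ∈ endpts fst snd e).card < (K g).card :=
        lt_of_le_of_lt (card_colour_meets_le hp _ _) (by exact_mod_cast hY)
      obtain ⟨e, heK, heY⟩ := Finset.exists_mem_notMem_of_card_lt_card hY'
      obtain ⟨hcg, x', hx', v', hv', he⟩ := (Finset.mem_filter.1 heK).2
      have heY' : ∀ w ∈ endpts fst snd e, w ∉ Y := fun w hw hwY =>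
        heY (Finset.mem_filter.2 ⟨Finset.mem_univ _, hcg, w, hwY, hw⟩)
      have heQ : e ∈ Q := by
        obtain ⟨hxM, hxA⟩ := Finset.mem_sdiff.1 hx'
        obtain ⟨m', hm', hxm'⟩ := mem_mVerts.1 hxM
        obtain ⟨z', hxz', hmz'⟩ := exists_endpts_eq hloop hxm'
        refine Finset.mem_filter.2 ⟨Finset.mem_univ _, m', Finset.mem_sdiff.2 ⟨hm', fun h' =>
          hxA (mem_mVerts.2 ⟨m', h', hxm'⟩)⟩, x', z', v', g, hgA, hxz', hmz', he, hv', hcg, ?_⟩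
        by_contra hd
        exact heY' v' (by simp [he])
          (Finset.mem_union_left _ (Finset.mem_filter.2 ⟨hv', hd⟩))
      refine ⟨e, heQ, ?_, fun b hb => ⟨fun h' => ?_, fun h' => ?_⟩⟩
      · exact hM.2 _ (h.subset (ha e heQ)) _ (h.subset hgA) ((hcol e heQ).symm.trans hcg)
      · refine heY' (x e) (by rw [hxv e heQ]; simp) (Finset.mem_union_right _
          (Finset.mem_union_right _ (mem_mVerts.2 ⟨m b, Finset.mem_image_of_mem _ hb, ?_⟩)))
        rw [← h', hmxz e heQ]
        simp
      · refine heY' (v e) (by rw [hxv e heQ]; simp) (Finset.mem_union_right _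
          (Finset.mem_union_left _ (Finset.mem_image.2 ⟨b, hb, h'.symm⟩))))
  obtain ⟨A', y', S', hsys, hA'⟩ := h.adjoin hM hC₀ hT (B := B)
    (fun e he => Finset.mem_sdiff.1 (hm e (hBQ he))) (fun e he => ha e (hBQ he))
    (fun e he => hxz e (hBQ he)) (fun e he => hmxz e (hBQ he)) (fun e he => hxv e (hBQ he))
    (fun e he => hv e (hBQ he)) (fun e he => hcol e (hBQ he)) (fun e he => hdisj e (hBQ he))
    hmi hvi hai
  refine ⟨A', y', S', hsys, ?_⟩
  rw [hA', hB, Nat.cast_add]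
  have := Nat.le_ceil (β / 4)
  linarith

end Extension

section InitialSystem

variable {V E C : Type*} [Fintype V] [DecidableEq V] [Fintype E] [DecidableEq E] [DecidableEq C]
  {fst snd : E → V} {col : E → C} {M : Finset E} {C₀ : Finset C} {P : ℕ}

lemma card_filter_mem_endpts_le
    (hp : ∀ e f v, v ∈ endpts fst snd e → v ∈ endpts fst snd f → col e = col f → e = f)
    (Q : Finset C) (x : V) :
    (Finset.univ.filter fun e : E => col e ∈ Q ∧ x ∈ endpts fst snd e).card ≤ Q.card := by
  refine Finset.card_le_card_of_injOn col ?_ ?_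
  · intro e he
    simp only [Finset.coe_filter, Set.mem_ofPred_eq] at he
    exact he.2.1
  · intro e he f hf hef
    simp only [Finset.coe_filter, Set.mem_ofPred_eq] at he hf
    exact hp e f x he.2.2 hf.2.2 hef

/-- The edges between `x` and uncovered vertices whose colour is unused. -/
def outEdges (fst snd : E → V) (col : E → C) (M : Finset E) (C₀ : Finset C) (x : V) : Finset E :=
  Finset.univ.filter fun e : E =>
    col e ∈ C₀ ∧ ∃ v ∉ mVerts fst snd M, endpts fst snd e = {x, v}

lemma exists_robust_support
    (hp : ∀ e f v, v ∈ endpts fst snd e → v ∈ endpts fst snd f → col e = col f → e = f)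
    {h : ℕ} (hh : P < h) {x : V} (hx : P * h + P < (outEdges fst snd col M C₀ x).card) :
    ∃ H : Finset V, H.card ≤ 1 ∧
      (∀ v ∈ H, v ∉ mVerts fst snd M ∧ h ≤ (Finset.univ.filter fun e : E =>
        col e ∈ C₀ ∧ endpts fst snd e = {x, v}).card) ∧
      ∀ (F : Finset V) (Q : Finset C), Disjoint F H → F.card ≤ P → Q.card ≤ P → ∃ e v,
        endpts fst snd e = {x, v} ∧ v ∉ mVerts fst snd M ∧ v ∉ F ∧ col e ∈ C₀ ∧ col e ∉ Q := by
  by_cases hv : ∃ v ∉ mVerts fst snd M, h ≤ (Finset.univ.filter fun e : E =>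
      col e ∈ C₀ ∧ endpts fst snd e = {x, v}).card
  · obtain ⟨v, hvM, hvh⟩ := hv
    refine ⟨{v}, by simp, ?_, fun F Q hF _ hQ => ?_⟩
    · intro w hw
      rw [Finset.mem_singleton.1 hw]
      exact ⟨hvM, hvh⟩
    · obtain ⟨e, he, heQ⟩ := Finset.exists_mem_notMem_of_card_lt_card
        (((card_filter_mem_endpts_le hp Q x).trans hQ).trans_lt (hh.trans_le hvh))
      simp only [Finset.mem_filter, Finset.mem_univ, true_and] at he heQ
      exact ⟨e, v, he.2, hvM, by simpa using hF, he.1, fun h' => heQ ⟨h', by simp [he.2]⟩⟩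
  · refine ⟨∅, by simp, by simp, fun F Q _ hF hQ => ?_⟩
    let B : Finset E := (F \ mVerts fst snd M).biUnion fun v => Finset.univ.filter fun e : E =>
      col e ∈ C₀ ∧ endpts fst snd e = {x, v}
    have hB : B.card ≤ P * h := by
      refine (Finset.card_biUnion_le_card_mul _ _ h fun v hvF => ?_).trans
        (Nat.mul_le_mul_right _ ((Finset.card_le_card Finset.sdiff_subset).trans hF))
      by_contra hlt
      exact hv ⟨v, (Finset.mem_sdiff.1 hvF).2, (not_le.1 hlt).le⟩
    have hlt : (B ∪ Finset.univ.filter fun e : E => col e ∈ Q ∧ x ∈ endpts fst snd e).card <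
        (outEdges fst snd col M C₀ x).card := by
      have := Finset.card_union_le B
        (Finset.univ.filter fun e : E => col e ∈ Q ∧ x ∈ endpts fst snd e)
      have := card_filter_mem_endpts_le hp Q x
      omega
    obtain ⟨e, he, heB⟩ := Finset.exists_mem_notMem_of_card_lt_card hlt
    obtain ⟨-, heC, v, hvM, hev⟩ := Finset.mem_filter.1 he
    refine ⟨e, v, hev, hvM, fun hvF => heB (Finset.mem_union_left _ ?_), heC,
      fun heQ => heB (Finset.mem_union_right _ ?_)⟩
    · exact Finset.mem_biUnion.2 ⟨v, Finset.mem_sdiff.2 ⟨hvF, hvM⟩,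
        Finset.mem_filter.2 ⟨Finset.mem_univ _, heC, hev⟩⟩
    · exact Finset.mem_filter.2 ⟨Finset.mem_univ _, heQ, by simp [hev]⟩

lemma two_mul_le_card_colour_outside (hloop : ∀ e : E, fst e ≠ snd e)
    (hp : ∀ e f v, v ∈ endpts fst snd e → v ∈ endpts fst snd f → col e = col f → e = f)
    (hM : IsRainbowMatching fst snd col M) (hC₀ : Disjoint C₀ (mCols col M))
    (hmax : ∀ M', IsRainbowMatching fst snd col M' → M'.card ≤ M.card) {β : ℝ}
    (hcard : ∀ c, M.card + β ≤ (Finset.univ.filter fun e : E => col e = c).card) {c : C}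
    (hc : c ∈ C₀) :
    2 * β ≤ (Finset.univ.filter fun e : E => col e = c ∧ ∃ x ∈ mVerts fst snd M,
      ∃ v ∈ (mVerts fst snd M)ᶜ, endpts fst snd e = {x, v}).card := by
  have h1 := two_mul_card_colour_le hloop hp (W := (mVerts fst snd M)ᶜ) (X := ∅)
    (U := mVerts fst snd M) (by intro v; simp only [Finset.mem_compl]; tauto) c
  have h2 : (Finset.univ.filter fun e : E =>
      col e = c ∧ endpts fst snd e ⊆ (mVerts fst snd M)ᶜ) = ∅ := by
    refine Finset.filter_eq_empty_iff.2 fun e _ ⟨hec, he⟩ => ?_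
    have hV : Disjoint (mVerts fst snd M) (mVerts fst snd {e}) := by
      rw [mVerts_singleton]
      exact Finset.disjoint_left.2 fun v hv hve => Finset.mem_compl.1 (he hve) hv
    have hM' := hM.union (isRainbowMatching_singleton e) hV (by
      rw [mCols_singleton, Finset.disjoint_singleton_right, hec]
      exact Finset.disjoint_left.1 hC₀ hc)
    have := hmax _ hM'
    rw [Finset.card_union_of_disjoint (disjoint_of_mVerts hV), Finset.card_singleton] at this
    omega
  rw [h2, hM.card_mVerts hloop subset_rfl] at h1
  simp only [Finset.card_empty, mul_zero, zero_add, add_zero] at h1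
  have h3 := (Nat.cast_le (α := ℝ)).2 h1
  push_cast at h3
  have h4 := hcard c
  linarith

lemma le_card_outEdges_large (hloop : ∀ e : E, fst e ≠ snd e)
    (hp : ∀ e f v, v ∈ endpts fst snd e → v ∈ endpts fst snd f → col e = col f → e = f)
    (hM : IsRainbowMatching fst snd col M) (hC₀ : Disjoint C₀ (mCols col M))
    (hmax : ∀ M', IsRainbowMatching fst snd col M' → M'.card ≤ M.card) {β : ℝ}
    (hcard : ∀ c, M.card + β ≤ (Finset.univ.filter fun e : E => col e = c).card)
    (hne : C₀.Nonempty) {θ : ℕ} (hθ : (2 * M.card * θ : ℝ) ≤ β * C₀.card) :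
    β ≤ ((mVerts fst snd M).filter fun x => θ < (outEdges fst snd col M C₀ x).card).card := by
  let K : C → Finset E := fun c => Finset.univ.filter fun e : E => col e = c ∧
    ∃ x ∈ mVerts fst snd M, ∃ v ∈ (mVerts fst snd M)ᶜ, endpts fst snd e = {x, v}
  have h1 : ∑ c ∈ C₀, (K c).card ≤
      ∑ x ∈ mVerts fst snd M, (outEdges fst snd col M C₀ x).card := by
    rw [← Finset.card_biUnion]
    · refine le_trans (Finset.card_le_card ?_) Finset.card_biUnion_le
      intro e he
      obtain ⟨c, hc, he⟩ := Finset.mem_biUnion.1 he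
      obtain ⟨-, rfl, x, hx, v, hv, hxv⟩ := Finset.mem_filter.1 he
      exact Finset.mem_biUnion.2 ⟨x, hx, Finset.mem_filter.2
        ⟨Finset.mem_univ _, hc, v, Finset.mem_compl.1 hv, hxv⟩⟩
    · intro c _ c' _ hcc'
      refine Finset.disjoint_left.2 fun e he he' => hcc' ?_
      exact (Finset.mem_filter.1 he).2.1.symm.trans (Finset.mem_filter.1 he').2.1
  have h2 : C₀.card * (2 * β) ≤ ∑ c ∈ C₀, ((K c).card : ℝ) := by
    rw [← nsmul_eq_mul]
    exact Finset.card_nsmul_le_sum _ _ _ fun c hc =>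
      two_mul_le_card_colour_outside hloop hp hM hC₀ hmax hcard hc
  set G := (mVerts fst snd M).filter fun x => θ < (outEdges fst snd col M C₀ x).card with hG
  have h3 : ∑ x ∈ mVerts fst snd M, (outEdges fst snd col M C₀ x).card ≤
      G.card * C₀.card + 2 * M.card * θ := by
    rw [← Finset.sum_filter_add_sum_filter_not _
      (fun x => θ < (outEdges fst snd col M C₀ x).card)]
    refine add_le_add (Finset.sum_le_card_nsmul _ _ _ fun x _ => ?_)
      ((Finset.sum_le_card_nsmul _ _ θ fun x hx => not_lt.1 (Finset.mem_filter.1 hx).2).trans ?_)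
    · refine le_trans (Finset.card_le_card ?_) (card_filter_mem_endpts_le hp C₀ x)
      intro e he
      obtain ⟨-, hc, v, -, hev⟩ := Finset.mem_filter.1 he
      exact Finset.mem_filter.2 ⟨Finset.mem_univ _, hc, by simp [hev]⟩
    · rw [smul_eq_mul, ← hM.card_mVerts hloop subset_rfl]
      exact Nat.mul_le_mul_right _ (Finset.card_le_card (Finset.filter_subset _ _))
  have h4 : (C₀.card * (2 * β) : ℝ) ≤ G.card * C₀.card + 2 * M.card * θ := by
    refine h2.trans ?_
    exact_mod_cast h1.trans h3
  have h5 : (0 : ℝ) < C₀.card := by exact_mod_cast hne.card_pos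
  refine le_of_mul_le_mul_right ?_ h5
  linarith

lemma exists_isSystem (hloop : ∀ e : E, fst e ≠ snd e)
    (hp : ∀ e f v, v ∈ endpts fst snd e → v ∈ endpts fst snd f → col e = col f → e = f)
    (hM : IsRainbowMatching fst snd col M) (hC₀ : Disjoint C₀ (mCols col M))
    (hmax : ∀ M', IsRainbowMatching fst snd col M' → M'.card ≤ M.card) {β : ℝ} (hβ : 0 < β)
    (hcard : ∀ c, M.card + β ≤ (Finset.univ.filter fun e : E => col e = c).card)
    (hne : C₀.Nonempty) {h t : ℕ} (hh : P < h)
    (hθ : (2 * M.card * (P * h + P : ℕ) : ℝ) ≤ β * C₀.card) (ht : 1 ≤ t)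
    (hth : C₀.card ≤ t * h) :
    ∃ A y S, IsSystem fst snd col M C₀ P A y S 1 3 t ∧ β / 2 ≤ A.card := by
  have hG := le_card_outEdges_large hloop hp hM hC₀ hmax hcard hne hθ
  set G := (mVerts fst snd M).filter fun x => P * h + P < (outEdges fst snd col M C₀ x).card
    with hGdef
  obtain ⟨v₀, -⟩ : G.Nonempty := Finset.card_pos.1 (by exact_mod_cast hβ.trans_le hG)
  have : Nonempty V := ⟨v₀⟩
  have hR : ∀ x ∈ G, _ := fun x hx =>
    exists_robust_support (M := M) (C₀ := C₀) hp hh (Finset.mem_filter.1 hx).2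
  choose! H hH1 hH2 hH3 using hR
  let A : Finset E := M.filter fun m => ∃ x ∈ endpts fst snd m, x ∈ G
  have hA : ∀ m ∈ A, ∃ x z, x ∈ G ∧ x ≠ z ∧ endpts fst snd m = {x, z} := by
    intro m hm
    obtain ⟨-, x, hx, hxG⟩ := Finset.mem_filter.1 hm
    obtain ⟨z, hxz, hmz⟩ := exists_endpts_eq hloop hx
    exact ⟨x, z, hxG, hxz, hmz⟩
  choose! x z hxG hxz hmxz using hA
  have hAM : A ⊆ M := Finset.filter_subset _ _
  refine ⟨A, z, fun m => {x m, z m} ∪ H (x m), ⟨hAM, ?_, ?_, ?_, ?_, ?_⟩, ?_⟩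
  · intro m hm
    rw [hmxz m hm]; simp
  · intro m hm
    exact freeable_of_forall_exists_edge hC₀ (hAM hm) (hxz m hm) (hmxz m hm) (hH3 _ (hxG m hm))
  · intro m hm
    exact (Finset.card_union_le _ _).trans
      (Nat.add_le_add Finset.card_le_two (hH1 _ (hxG m hm)))
  · intro m hm
    rw [← hmxz m hm]
    refine Finset.union_subset_union (fun w hw => mem_mVerts.2 ⟨m, hm, hw⟩) fun w hw => ?_
    exact Finset.mem_compl.2 (hH2 _ (hxG m hm) w hw).1
  · intro f
    by_cases hf : f ∈ mVerts fst snd M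
    · refine le_trans (Finset.card_le_one.2 ?_) ht
      have key : ∀ m ∈ A, f ∈ ({x m, z m} ∪ H (x m) : Finset V) → f ∈ endpts fst snd m := by
        intro m hm hfm
        rcases Finset.mem_union.1 hfm with hfm | hfm
        · rwa [hmxz m hm]
        · exact absurd hf (hH2 _ (hxG m hm) f hfm).1
      intro m hm m' hm'
      obtain ⟨hm, hfm⟩ := Finset.mem_filter.1 hm
      obtain ⟨hm', hfm'⟩ := Finset.mem_filter.1 hm'
      exact hM.eq_of_mem (hAM hm) (hAM hm') (key m hm hfm) (key m' hm' hfm')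
    · have key : ∀ m ∈ A.filter (fun m => f ∈ ({x m, z m} ∪ H (x m) : Finset V)),
          m ∈ A ∧ f ∈ H (x m) := by
        intro m hm
        obtain ⟨hm, hfm⟩ := Finset.mem_filter.1 hm
        refine ⟨hm, (Finset.mem_union.1 hfm).resolve_left fun hfm => hf ?_⟩
        rw [← hmxz m hm] at hfm
        exact mem_mVerts.2 ⟨m, hAM hm, hfm⟩
      have hle : (A.filter fun m => f ∈ ({x m, z m} ∪ H (x m) : Finset V)).card * h ≤
          C₀.card := by
        refine le_trans ?_ (card_filter_mem_endpts_le hp C₀ f)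
        rw [← smul_eq_mul]
        refine (Finset.card_nsmul_le_sum _ (fun m => (Finset.univ.filter fun e : E =>
          col e ∈ C₀ ∧ endpts fst snd e = {x m, f}).card) _ fun m hm => ?_).trans ?_
        · exact (hH2 _ (hxG m (key m hm).1) f (key m hm).2).2
        · rw [← Finset.card_biUnion]
          · refine Finset.card_le_card fun e he => ?_
            obtain ⟨m, hm, he⟩ := Finset.mem_biUnion.1 he
            obtain ⟨-, hec, he⟩ := Finset.mem_filter.1 he
            exact Finset.mem_filter.2 ⟨Finset.mem_univ _, hec, by simp [he]⟩
          · intro m hm m' hm' hne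
            refine Finset.disjoint_left.2 fun e he he' => hne ?_
            have hmA := (key m hm).1
            have hmA' := (key m' hm').1
            have hx : x m ∈ endpts fst snd e := by simp [(Finset.mem_filter.1 he).2.2]
            rw [(Finset.mem_filter.1 he').2.2] at hx
            have hxM : x m ∈ endpts fst snd m := by simp [hmxz m hmA]
            have hxf : x m ≠ f := fun h' => hf (h' ▸ mem_mVerts.2 ⟨m, hAM hmA, hxM⟩)
            have hxx : x m = x m' := by simpa [hxf] using hx
            refine hM.eq_of_mem (hAM hmA) (hAM hmA') hxM ?_
            rw [hmxz m' hmA', hxx]; simp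
      exact Nat.le_of_mul_le_mul_right (hle.trans hth) (by omega)
  · have hsub : G ⊆ mVerts fst snd A := by
      intro w hw
      obtain ⟨m, hm, hwm⟩ := mem_mVerts.1 (Finset.mem_filter.1 hw).1
      exact mem_mVerts.2 ⟨m, Finset.mem_filter.2 ⟨hm, w, hwm, hw⟩, hwm⟩
    have h1 : (G.card : ℝ) ≤ 2 * A.card := by
      exact_mod_cast (Finset.card_le_card hsub).trans (card_mVerts_le A)
    linarith

end InitialSystem

section Parameters

variable {V E C : Type*} [Fintype V] [DecidableEq V] [Fintype E] [DecidableEq E] [DecidableEq C]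
  {fst snd : E → V} {col : E → C} {M : Finset E} {C₀ : Finset C} {P : ℕ}
  {A : Finset E} {y : E → V} {S : E → Finset V} {t : ℕ}

lemma IsSystem.iterate_extend (hloop : ∀ e : E, fst e ≠ snd e)
    (hp : ∀ e f v, v ∈ endpts fst snd e → v ∈ endpts fst snd f → col e = col f → e = f)
    (hM : IsRainbowMatching fst snd col M) (hC₀ : Disjoint C₀ (mCols col M))
    (hmax : ∀ M', IsRainbowMatching fst snd col M' → M'.card ≤ M.card)
    (h : IsSystem fst snd col M C₀ P A y S 1 3 t) {μ J : ℕ} (hP : 27 * 2 ^ J ≤ P)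
    (hμ : ∀ u v : V, (Finset.univ.filter fun e : E => endpts fst snd e = {u, v}).card ≤ μ)
    {β : ℝ} (hβ : 0 < β)
    (hcard : ∀ c, M.card + β ≤ (Finset.univ.filter fun e : E => col e = c).card)
    (hA : β / 2 ≤ A.card) (hsmall : 5 * 2 ^ J * (3 ^ J * (t + 1)) * (1 + μ) ≤ β / 8) :
    β / 2 + J * (β / 4) ≤ M.card := by
  suffices H : ∀ j ≤ J, ∃ A' y' S' s σ t', IsSystem fst snd col M C₀ P A' y' S' s σ t' ∧
      s + 1 = 2 * 2 ^ j ∧ σ + 2 = 5 * 2 ^ j ∧ t' + 1 = 3 ^ j * (t + 1) ∧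
      β / 2 + j * (β / 4) ≤ A'.card by
    obtain ⟨A', y', S', s, σ, t', h', -, -, -, hA'⟩ := H J le_rfl
    refine hA'.trans ?_
    exact_mod_cast Finset.card_le_card h'.subset
  intro j
  induction j with
  | zero => exact fun _ => ⟨A, y, S, 1, 3, t, h, by simp, by simp, by simp, by simpa using hA⟩
  | succ j ih =>
    intro hj
    obtain ⟨A', y', S', s, σ, t', h', hs, hσ, ht, hA'⟩ := ih (by omega)
    have h2 : 2 ^ j ≤ 2 ^ J := Nat.pow_le_pow_right (by norm_num) (by omega)
    have h2' : 0 < 2 ^ j := by positivity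
    have h3 : 3 ^ j ≤ 3 ^ J := Nat.pow_le_pow_right (by norm_num) (by omega)
    obtain ⟨A'', y'', S'', h'', hA''⟩ := h'.extend hloop hp hM hC₀ hmax (by omega) (by omega) hμ hβ
      hcard (le_trans (by have : (0 : ℝ) ≤ j * (β / 4) := by positivity
                          linarith) hA')
      (by
        refine le_trans ?_ hsmall
        have : σ * (t' + 1) * (1 + μ) ≤ 5 * 2 ^ J * (3 ^ J * (t + 1)) * (1 + μ) := by
          rw [ht]
          gcongr
          omega
        exact_mod_cast this)
    refine ⟨A'', y'', S'', _, _, _, h'', by rw [pow_succ]; omega, by rw [pow_succ]; omega, ?_, ?_⟩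
    · calc 3 * t' + 2 + 1 = 3 * (t' + 1) := by ring
        _ = _ := by rw [ht, pow_succ]; ring
    · push_cast
      linarith

lemma exists_parameters {ε k : ℝ} (hε0 : 0 < ε) (hε1 : ε < 1 / 1000)
    (hk : k = (2 : ℝ) ^ (20 / ε)) :
    ∃ J P t : ℕ, 4 ≤ J * ε ∧ 27 * 2 ^ J ≤ P ∧ 1 ≤ t ∧
      (80 * 2 ^ J * (3 ^ J * (t + 1)) : ℝ) ≤ ε * k ∧
      ∀ c : ℕ, k ≤ c → ∃ h : ℕ, P < h ∧ (2 * (P * h + P : ℕ) : ℝ) ≤ ε * c ∧ c ≤ t * h := by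
  obtain ⟨L, hL⟩ : ∃ L, L = 1 / ε := ⟨_, rfl⟩
  have hεL : ε = 1 / L := by rw [hL]; simp
  have hL1 : 1000 < L := by
    rw [hL, lt_div_iff₀ hε0]; linarith
  have hL0 : 0 < L := by linarith
  obtain ⟨X, hX⟩ : ∃ X, X = (2 : ℝ) ^ (4 * L) := ⟨_, rfl⟩
  have hkX : k = X ^ 5 := by
    rw [hk, hX, ← Real.rpow_mul_natCast (by norm_num)]
    congr 1
    rw [hL]; push_cast; ring
  have hXL : L ^ 4 ≤ X := by
    have h1 : 1 + L * 1 ≤ (1 + 1 : ℝ) ^ L :=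
      one_add_mul_self_le_rpow_one_add (by norm_num) (by linarith)
    have h2 : X = ((1 + 1 : ℝ) ^ L) ^ 4 := by
      rw [hX, ← Real.rpow_mul_natCast (by norm_num)]
      norm_num [mul_comm]
    rw [h2]
    exact pow_le_pow_left₀ hL0.le (by linarith) 4
  have hX6 : 1000000 * L ^ 2 ≤ X := by
    refine le_trans ?_ hXL
    calc 1000000 * L ^ 2 ≤ L ^ 2 * L ^ 2 := by gcongr; nlinarith
      _ = L ^ 4 := by ring
  have hX1 : 1000000 ≤ X := by nlinarith
  have hX0 : 0 < X := by linarith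
  let J : ℕ := ⌈4 * L⌉₊
  have hJ : (2 : ℝ) ^ J ≤ 2 * X := by
    have h1 : (J : ℝ) ≤ 4 * L + 1 := (Nat.ceil_lt_add_one (by positivity)).le
    calc (2 : ℝ) ^ J = (2 : ℝ) ^ (J : ℝ) := (Real.rpow_natCast _ _).symm
      _ ≤ (2 : ℝ) ^ (4 * L + 1) := Real.rpow_le_rpow_of_exponent_le (by norm_num) h1
      _ = 2 * X := by rw [Real.rpow_add (by norm_num), hX, Real.rpow_one, mul_comm]
  have hJ3 : (3 : ℝ) ^ J ≤ 4 * X ^ 2 := by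
    calc (3 : ℝ) ^ J ≤ 4 ^ J := by gcongr; norm_num
      _ = (2 ^ J) ^ 2 := by rw [← pow_mul, mul_comm, pow_mul]; norm_num
      _ ≤ (2 * X) ^ 2 := by gcongr
      _ = _ := by ring
  obtain ⟨P, hPdef⟩ : ∃ P : ℕ, P = 27 * 2 ^ J := ⟨_, rfl⟩
  have hP0 : 1 ≤ (P : ℝ) := by
    have : 0 < 2 ^ J := by positivity
    exact_mod_cast (by omega : 1 ≤ P)
  have hP : (P : ℝ) ≤ 54 * X := by
    rw [hPdef]; push_cast; linarith
  have hPL : (P : ℝ) * L ≤ 54 * X * L := by gcongr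
  have hPL1 : 1 ≤ (P : ℝ) * L := by nlinarith
  let t : ℕ := ⌈8 * P * L⌉₊
  have ht1 : 8 * P * L ≤ (t : ℝ) := Nat.le_ceil _
  have ht2 : (t : ℝ) ≤ 8 * P * L + 1 := (Nat.ceil_lt_add_one (by positivity)).le
  refine ⟨J, P, t, ?_, hPdef.ge, ?_, ?_, ?_⟩
  · have : 4 * L ≤ J := Nat.le_ceil _
    rw [hεL, mul_one_div, le_div_iff₀ hL0]
    exact this
  · exact Nat.one_le_ceil_iff.2 (by positivity)
  · rw [hεL, hkX, one_div_mul_eq_div, le_div_iff₀ hL0]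
    have h1 : (t : ℝ) + 1 ≤ 434 * X * L := by nlinarith
    calc 80 * 2 ^ J * (3 ^ J * ((t : ℝ) + 1)) * L
        ≤ 80 * (2 * X) * (4 * X ^ 2 * (434 * X * L)) * L := by gcongr
      _ = X ^ 4 * (277760 * L ^ 2) := by ring
      _ ≤ X ^ 4 * X := by gcongr; nlinarith
      _ = X ^ 5 := by ring
  · intro c hc
    have hc0 : X ^ 5 ≤ c := hkX ▸ hc
    have hPP : 8 * P * L * (P + 1) ≤ (c : ℝ) := by
      refine le_trans ?_ hc0
      calc 8 * P * L * (P + 1) ≤ 8 * (54 * X) * L * (54 * X + X) := by gcongr; linarith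
        _ = X ^ 2 * (23760 * L) := by ring
        _ ≤ X ^ 2 * X := by gcongr; nlinarith
        _ ≤ X ^ 5 := by rw [← pow_succ]; exact pow_le_pow_right₀ (by linarith) (by norm_num)
    have h4 : (0 : ℝ) < 4 * P * L := by nlinarith
    let h : ℕ := ⌊(c : ℝ) / (4 * P * L)⌋₊
    have hh1 : (h : ℝ) * (4 * P * L) ≤ c := by
      rw [← le_div_iff₀ h4]
      exact Nat.floor_le (by positivity)
    have hh2 : (c : ℝ) < (h + 1) * (4 * P * L) := by
      rw [← div_lt_iff₀ h4]
      exact Nat.lt_floor_add_one _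
    have hh3 : (P : ℝ) < h := by
      by_contra hlt
      have hle := not_lt.1 hlt
      nlinarith
    refine ⟨h, by exact_mod_cast hh3, ?_, ?_⟩
    · rw [hεL, one_div_mul_eq_div, le_div_iff₀ hL0]
      push_cast
      nlinarith
    · have : (c : ℝ) ≤ t * h := by
        have h5 : (h + 1 : ℝ) ≤ 2 * h := by linarith
        calc (c : ℝ) ≤ (h + 1) * (4 * P * L) := hh2.le
          _ ≤ 2 * h * (4 * P * L) := by gcongr
          _ = 8 * P * L * h := by ring
          _ ≤ t * h := by gcongr
      exact_mod_cast this

end Parameters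

/-- **Theorem 1.3.** Let `0 < ε < 10⁻³`, `k = 2^{20/ε}` and `n > k²`.  Any multigraph
with edge multiplicities at most `n/k` that is properly edge-coloured with `n` colours
so that every colour appears at least `(1+ε)n` times has a rainbow matching of
size `n - k`. -/
theorem stmt0 {V E C : Type*} [Fintype V] [DecidableEq V] [Fintype E] [DecidableEq E]
    [Fintype C] [DecidableEq C]
    (ε k : ℝ) (hε0 : 0 < ε) (hε1 : ε < 1/1000)
    (hk : k = (2:ℝ) ^ (20/ε))
    (n : ℕ) (hn : (n:ℝ) > k^2)
    (fst snd : E → V) (col : E → C)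
    (hloop : ∀ e : E, fst e ≠ snd e)
    (hproper : ∀ e f : E, e ≠ f → (endpts fst snd e ∩ endpts fst snd f).Nonempty →
      col e ≠ col f)
    (hC : Fintype.card C = n)
    (hmult : ∀ u v : V,
      ((Finset.univ.filter fun e : E => endpts fst snd e = ({u, v} : Finset V)).card : ℝ) ≤ n / k)
    (habund : ∀ c : C, (1+ε) * n ≤ ((Finset.univ.filter fun e : E => col e = c).card : ℝ)) :
    ∃ S : Finset E, IsRainbowMatching fst snd col S ∧ (n : ℝ) - k ≤ (S.card : ℝ) := by
  have hp : ∀ e f v, v ∈ endpts fst snd e → v ∈ endpts fst snd f → col e = col f → e = f := by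
    intro e f v he hf hef
    by_contra hne
    exact hproper e f hne ⟨v, Finset.mem_inter.2 ⟨he, hf⟩⟩ hef
  obtain ⟨M, hMmem, hmax'⟩ := Finset.exists_max_image
    (Finset.univ.filter fun S : Finset E => IsRainbowMatching fst snd col S) Finset.card
    ⟨∅, Finset.mem_filter.2 ⟨Finset.mem_univ _, by simp [IsRainbowMatching]⟩⟩
  have hM : IsRainbowMatching fst snd col M := (Finset.mem_filter.1 hMmem).2
  have hmax : ∀ M', IsRainbowMatching fst snd col M' → M'.card ≤ M.card := fun M' hM' =>
    hmax' M' (Finset.mem_filter.2 ⟨Finset.mem_univ _, hM'⟩)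
  refine ⟨M, hM, ?_⟩
  by_contra hlt
  have hlt' : (M.card : ℝ) < n - k := not_le.1 hlt
  have hk1 : 1 ≤ k := by
    rw [hk]
    exact Real.one_le_rpow (by norm_num) (by positivity)
  have hk0 : 0 < k := by linarith
  have hkn : k ≤ n := by nlinarith
  have hn0 : (0 : ℝ) < n := by linarith
  have hMn : M.card ≤ n := by
    have : (M.card : ℝ) ≤ n := by linarith
    exact_mod_cast this
  obtain ⟨J, P, t, hJ, hP, ht, hsmall, hc⟩ := exists_parameters hε0 hε1 hk
  have hMcol : (mCols col M).card = M.card :=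
    Finset.card_image_of_injOn fun e he f hf hef => hM.2 e he f hf hef
  have hC₀ : Disjoint (mCols col M)ᶜ (mCols col M) := disjoint_compl_left
  have hcardC : (((mCols col M)ᶜ.card : ℕ) : ℝ) = n - M.card := by
    rw [Finset.card_compl, hC, hMcol, Nat.cast_sub hMn]
  obtain ⟨h, hh, hθ, hth⟩ := hc (mCols col M)ᶜ.card (by rw [hcardC]; linarith)
  have hne : (mCols col M)ᶜ.Nonempty := by
    refine Finset.card_pos.1 ?_
    have : (0 : ℝ) < (mCols col M)ᶜ.card := by rw [hcardC]; linarith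
    exact_mod_cast this
  have hβ : 0 < ε * n := by positivity
  have hcard : ∀ c, M.card + ε * n ≤ (Finset.univ.filter fun e : E => col e = c).card := by
    intro c
    refine le_trans ?_ (habund c)
    linarith
  obtain ⟨A, y, S, hsys, hA⟩ := exists_isSystem hloop hp hM hC₀ hmax hβ hcard hne hh
    (by
      calc (2 * M.card * (P * h + P : ℕ) : ℝ) = M.card * (2 * (P * h + P : ℕ)) := by ring
        _ ≤ n * (ε * (mCols col M)ᶜ.card) := by gcongr
        _ = _ := by ring) ht hth
  have hfin := hsys.iterate_extend hloop hp hM hC₀ hmax (J := J) (μ := ⌊(n : ℝ) / k⌋₊) hP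
    (fun u v => Nat.le_floor (hmult u v)) hβ hcard hA (by
      have h1 : (1 + ⌊(n : ℝ) / k⌋₊ : ℝ) ≤ 2 * (n / k) := by
        have h2 : (⌊(n : ℝ) / k⌋₊ : ℝ) ≤ n / k := Nat.floor_le (by positivity)
        have h3 : 1 ≤ n / k := (one_le_div hk0).2 hkn
        linarith
      calc (5 * 2 ^ J * (3 ^ J * (t + 1)) * (1 + ⌊(n : ℝ) / k⌋₊) : ℝ)
          ≤ 5 * 2 ^ J * (3 ^ J * (t + 1)) * (2 * (n / k)) := by gcongr
        _ = 80 * 2 ^ J * (3 ^ J * (t + 1)) * (n / k) / 8 := by ring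
        _ ≤ ε * k * (n / k) / 8 := by gcongr
        _ = ε * n / 8 := by field_simp)
  nlinarith
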